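/- arXiv:2202.11032 — 3 statements merged into one kernel-verified Lean document; each statement's English description precedes it below -/
import Mathlib

section
/- Let p be an odd prime and k a positive integer. Then the monomial X^k is planar over the finite field with p elements if and only if k ≡ 2 (mod p − 1). -/
open Polynomial in
theorem moment_zero (p : ℕ) (hp : p.Prime) (F : Type*) [Field F] [Fintype F]
    (hF : Fintype.card F = p) [CharP F p] (k h : ℕ) (hh : p = 2 * h + 1)
    (H : ∀ a : F, a ≠ 0 → Function.Bijective (fun x : F => (x + a) ^ k - x ^ k))
    (c : F) (l : ℕ) (hl : l < h) : ∑ x : F, (x ^ k + c * x) ^ l = 0 := by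
  induction l using Nat.strong_induction_on with
  | _ l ih =>
  rcases Nat.eq_zero_or_pos l with h0 | hpos
  · subst h0
    simp [hF]
  set g : F → F := fun x => x ^ k + c * x with hg
  have T : ∑ a : F, ∑ x : F, (g (x + a) - g x) ^ (2 * l) = 0 := by
    apply Finset.sum_eq_zero
    intro a _
    by_cases ha : a = 0
    · subst ha
      apply Finset.sum_eq_zero
      intro x _
      simp [hpos.ne']
    · have hb : Function.Bijective (fun x : F => g (x + a) - g x) := by
        have h1 := (Equiv.addRight (c * a)).bijective.comp (H a ha)
        convert h1 using 1
        funext x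
        simp [hg]
        ring
      have := hb.sum_comp (fun u : F => u ^ (2 * l))
      rw [this]
      apply FiniteField.sum_pow_lt_card_sub_one
      omega
  have T2 : ∑ x : F, ∑ y : F, (g y - g x) ^ (2 * l) = 0 := by
    rw [Finset.sum_comm] at T
    rw [← T]
    apply Finset.sum_congr rfl
    intro x _
    exact (Equiv.sum_comp (Equiv.addLeft x) (fun y => (g y - g x) ^ (2 * l))).symm
  have T3 : ∑ x : F, ∑ y : F, (g y - g x) ^ (2 * l)
      = ∑ m ∈ Finset.range (2 * l + 1), (-1) ^ (2 * l - m) * ((2 * l).choose m : F) *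
        ((∑ y : F, g y ^ m) * (∑ x : F, g x ^ (2 * l - m))) := by
    have e : ∀ x y : F, (g y - g x) ^ (2 * l) = ∑ m ∈ Finset.range (2 * l + 1),
        (-1) ^ (2 * l - m) * ((2 * l).choose m : F) * (g y ^ m * g x ^ (2 * l - m)) := by
      intro x y
      rw [sub_eq_add_neg, add_pow]
      apply Finset.sum_congr rfl
      intro m _
      rw [neg_pow (g x)]
      ring
    simp_rw [e]
    have e2 : ∀ x : F, ∑ y : F, ∑ m ∈ Finset.range (2 * l + 1),
        (-1) ^ (2 * l - m) * ((2 * l).choose m : F) * (g y ^ m * g x ^ (2 * l - m)) =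
        ∑ m ∈ Finset.range (2 * l + 1), ∑ y : F,
        (-1) ^ (2 * l - m) * ((2 * l).choose m : F) * (g y ^ m * g x ^ (2 * l - m)) :=
      fun x => Finset.sum_comm
    simp_rw [e2]
    rw [Finset.sum_comm]
    apply Finset.sum_congr rfl
    intro m _
    rw [Finset.sum_mul_sum, Finset.mul_sum, Finset.sum_comm]
    simp_rw [Finset.mul_sum]
  rw [T2, Finset.sum_eq_single l] at T3
  · have hc : ((2 * l).choose l : F) ≠ 0 := by
      rw [Ne, CharP.cast_eq_zero_iff F p]
      intro hd
      have h3 : p ∣ (2 * l).factorial :=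
        hd.trans ⟨l.factorial * (2 * l - l).factorial, by
          rw [← Nat.choose_mul_factorial_mul_factorial (show l ≤ 2 * l by omega)]; ring⟩
      have := (hp.dvd_factorial).1 h3
      omega
    have h2 : 2 * l - l = l := by omega
    rw [h2] at T3
    have := T3.symm
    simpa [hc] using this
  · intro m hm hne
    have hm' := Finset.mem_range.1 hm
    rcases lt_or_gt_of_ne hne with h1 | h1
    · rw [ih m h1 (by omega)]; ring
    · rw [ih (2 * l - m) (by omega) (by omega)]; ring
  · intro hm
    exact absurd (Finset.mem_range.2 (by omega)) hm

open Polynomial in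
theorem coeff_zero' (p : ℕ) (hp : p.Prime) (F : Type*) [Field F] [Fintype F]
    (hF : Fintype.card F = p) [CharP F p] (k h : ℕ) (hh : p = 2 * h + 1)
    (H : ∀ a : F, a ≠ 0 → Function.Bijective (fun x : F => (x + a) ^ k - x ^ k))
    (i j : ℕ) (hl : i + j < h) : ∑ x : F, x ^ (k * i + j) = 0 := by
  set P : F[X] := ∑ m ∈ Finset.range (i + j + 1),
    C (((i + j).choose m : F) * ∑ x : F, x ^ (k * (i + j - m) + m)) * X ^ m with hP
  have hdeg : P.natDegree < Fintype.card F := by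
    refine lt_of_le_of_lt (natDegree_sum_le_of_forall_le (n := i + j) _ _ ?_) (by omega)
    intro m hm
    have := Finset.mem_range.1 hm
    exact (natDegree_C_mul_X_pow_le _ _).trans (by omega)
  have hev : ∀ c : F, P.eval c = 0 := by
    intro c
    rw [← moment_zero p hp F hF k h hh H c (i + j) hl, hP, eval_finset_sum]
    have e : ∀ x : F, (x ^ k + c * x) ^ (i + j) = ∑ m ∈ Finset.range (i + j + 1),
        ((i + j).choose m : F) * x ^ (k * (i + j - m) + m) * c ^ m := by
      intro x
      rw [add_comm, add_pow]
      apply Finset.sum_congr rfl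
      intro m _
      rw [mul_pow, pow_add, pow_mul]
      ring
    simp_rw [e]
    rw [Finset.sum_comm]
    apply Finset.sum_congr rfl
    intro m _
    simp only [eval_mul, eval_C, eval_pow, eval_X, Finset.mul_sum, Finset.sum_mul]
  have hP0 : P = 0 :=
    eq_zero_of_natDegree_lt_card_of_eval_eq_zero P (f := id) Function.injective_id hev hdeg
  have hcf : P.coeff j = ((i + j).choose j : F) * ∑ x : F, x ^ (k * (i + j - j) + j) := by
    rw [hP, finset_sum_coeff, Finset.sum_eq_single j]
    · rw [coeff_C_mul_X_pow, if_pos rfl]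
    · intro m _ hne
      rw [coeff_C_mul_X_pow, if_neg hne.symm]
    · intro hm
      exact absurd (Finset.mem_range.2 (by omega)) hm
  rw [hP0, coeff_zero, Nat.add_sub_cancel] at hcf
  have hc : ((i + j).choose j : F) ≠ 0 := by
    rw [Ne, CharP.cast_eq_zero_iff F p]
    intro hd
    have h3 : p ∣ (i + j).factorial :=
      hd.trans ⟨j.factorial * (i + j - j).factorial, by
        rw [← Nat.choose_mul_factorial_mul_factorial (show j ≤ i + j by omega)]; ring⟩
    have := (hp.dvd_factorial).1 h3
    omega
  exact (mul_eq_zero.1 hcf.symm).resolve_left hc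

theorem arith_aux (k h : ℕ) (hk : 3 ≤ k) (hkh : k ≤ h) (hex : h ≠ 4) :
    2 * h / k + 2 * h % k < h := by
  have h1 := Nat.div_add_mod (2 * h) k
  have h2 := Nat.mod_lt (2 * h) (show 0 < k by omega)
  have h3 : 2 ≤ 2 * h / k := (Nat.le_div_iff_mul_le (by omega)).2 (by omega)
  generalize 2 * h / k = q at *
  generalize 2 * h % k = j at *
  obtain ⟨t, rfl⟩ : ∃ t, k = t + 3 := ⟨k - 3, by omega⟩
  rcases Nat.eq_zero_or_pos t with rfl | ht
  · omega
  · nlinarith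

theorem aux_reduced (p : ℕ) (hp : p.Prime) (F : Type*) [Field F] [Fintype F]
    (hF : Fintype.card F = p) [CharP F p] (k h : ℕ) (hh : p = 2 * h + 1)
    (H : ∀ a : F, a ≠ 0 → Function.Bijective (fun x : F => (x + a) ^ k - x ^ k))
    (hk1 : 1 ≤ k) (hk2 : k ≤ 2 * h) : k = 2 := by
  by_contra hne
  have key : ∀ i j : ℕ, i + j < h → k * i + j = 2 * h → False := by
    intro i j hij e
    have h1 := coeff_zero' p hp F hF k h hh H i j hij
    rw [e] at h1
    have h2 : 2 * h = Fintype.card F - 1 := by omega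
    have h3 : ∑ x : F, x ^ (2 * h) = -1 := by
      classical
      have : ∀ x : F, x ^ (2 * h) = 1 - (if x = 0 then 1 else 0) := by
        intro x
        split_ifs with hx
        · subst hx
          rw [zero_pow (by omega)]; ring
        · rw [h2, FiniteField.pow_card_sub_one_eq_one x hx]; ring
      simp_rw [this]
      simp [hF]
    rw [h3] at h1
    exact one_ne_zero (neg_eq_zero.1 h1)
  rcases Nat.lt_or_ge k 3 with h3 | h3
  · have hk : k = 1 := by omega
    subst hk
    have := (H 1 one_ne_zero).1 (a₁ := 0) (a₂ := 1) (by simp)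
    exact zero_ne_one this
  rcases Nat.lt_or_ge h k with h4 | h4
  · rcases Nat.lt_or_ge (h + 1) k with h5 | h5
    · exact key 1 (2 * h - k) (by omega) (by omega)
    · have hk : k = h + 1 := by omega
      have n2 : (2 : F) ≠ 0 := by
        have : ((2 : ℕ) : F) ≠ 0 := by
          rw [Ne, CharP.cast_eq_zero_iff F p]
          intro hd
          have := Nat.le_of_dvd (by omega) hd
          omega
        exact_mod_cast this
      have n3 : (3 : F) ≠ 0 := by
        have : ((3 : ℕ) : F) ≠ 0 := by
          rw [Ne, CharP.cast_eq_zero_iff F p]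
          intro hd
          have := Nat.le_of_dvd (by omega) hd
          omega
        exact_mod_cast this
      have n4 : (4 : F) ≠ 0 := by
        have : (4 : F) = 2 * 2 := by norm_num
        rw [this]; exact mul_ne_zero n2 n2
      have sq : ∀ u : F, (u ^ 2) ^ k = u ^ 2 := by
        intro u
        rw [← pow_mul, show 2 * k = p + 1 by omega, pow_succ, ← hF, FiniteField.pow_card]
        ring
      have := (H 1 one_ne_zero).1 (a₁ := 0) (a₂ := (3 / 4) ^ 2) (by
        have e : ((3 / 4 : F) ^ 2 + 1) = (5 / 4) ^ 2 := by field_simp; norm_num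
        simp only []
        rw [e, sq, sq, ← e, zero_pow (by omega)]
        simp)
      exact (pow_ne_zero 2 (div_ne_zero n3 n4)) this.symm
  · refine key (2 * h / k) (2 * h % k) (arith_aux k h h3 h4 ?_) (Nat.div_add_mod _ _)
    rintro rfl
    subst hh
    norm_num at hp

theorem stmt_9 (p : ℕ) (hp : p.Prime) (hodd : Odd p) (k : ℕ) (hk : 0 < k)
    (F : Type*) [Field F] [Fintype F] (hF : Fintype.card F = p) :
    (∀ a : F, a ≠ 0 → Function.Bijective (fun x : F => (x + a) ^ k - x ^ k)) ↔
      k ≡ 2 [MOD p - 1] := by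
  obtain ⟨h, hh⟩ := hodd
  have hp2 := hp.two_le
  haveI : Fact p.Prime := ⟨hp⟩
  haveI : CharP F p := charP_of_card_eq_prime hF
  have hpow : ∀ m n : ℕ, 0 < m → 0 < n → m ≡ n [MOD p - 1] → ∀ x : F, x ^ m = x ^ n := by
    intro m n hm hn hmn x
    by_cases hx : x = 0
    · subst hx; rw [zero_pow hm.ne', zero_pow hn.ne']
    · have h1 : x ^ (p - 1) = 1 := by
        rw [← hF]; exact FiniteField.pow_card_sub_one_eq_one x hx
      rw [← Nat.mod_add_div m (p - 1), ← Nat.mod_add_div n (p - 1), pow_add, pow_add, pow_mul,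
        pow_mul, h1, one_pow, one_pow, hmn]
  constructor
  · intro H
    set k' := (k - 1) % (p - 1) + 1 with hk'
    have hmod : k' ≡ k [MOD p - 1] := by
      have := (Nat.mod_modEq (k - 1) (p - 1)).add_right 1
      rwa [Nat.sub_add_cancel hk] at this
    have hlt := Nat.mod_lt (k - 1) (show 0 < p - 1 by omega)
    have := aux_reduced p hp F hF k' h hh (by
      intro a ha
      have := H a ha
      simpa only [hpow k' k (by omega) hk hmod] using this) (by omega) (by omega)
    rw [this] at hmod
    exact hmod.symm
  · intro hmod a ha
    have n2 : (2 : F) ≠ 0 := by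
      have : ((2 : ℕ) : F) ≠ 0 := by
        rw [Ne, CharP.cast_eq_zero_iff F p]
        intro hd
        have := Nat.le_of_dvd (by omega) hd
        omega
      exact_mod_cast this
    simp only [hpow k 2 hk (by omega) hmod]
    apply Finite.injective_iff_bijective.1
    intro x y hxy
    have : 2 * a * (x - y) = 0 := by
      simp only [] at hxy
      linear_combination hxy
    exact sub_eq_zero.1 ((mul_eq_zero.1 this).resolve_left (mul_ne_zero n2 ha))
end

section
/- Let p be an odd prime and k a positive integer. Then the monomial X^k is planar over the finite field with p^2 elements if and only if k ≡ 2 (mod p^2 − 1) or k ≡ 2p (mod p^2 − 1). -/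
open Finset

theorem powsum {F : Type*} [Field F] [Fintype F] (i : ℕ) (hi : 0 < i) :
    ∑ x : F, x ^ i = if (Fintype.card F - 1) ∣ i then -1 else 0 := by
  classical
  rw [← FiniteField.sum_pow_units F i]
  rw [← Finset.sum_erase_add _ _ (Finset.mem_univ (0:F))]
  rw [zero_pow hi.ne', add_zero]
  symm
  apply Finset.sum_bij (fun (u : Fˣ) _ => (u : F))
  · intro u _; simp
  · intro u _ v _ h; exact Units.ext h
  · intro b hb; exact ⟨Units.mk0 b (by simpa using hb), by simp, rfl⟩
  · intro u _; simp

theorem pow_congr {F : Type*} [Field F] [Fintype F] (k l : ℕ) (hk : 0 < k) (hl : 0 < l)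
    (h : k ≡ l [MOD Fintype.card F - 1]) (x : F) : x ^ k = x ^ l := by
  by_cases hx : x = 0
  · subst hx; rw [zero_pow hk.ne', zero_pow hl.ne']
  · have h2 : k ≡ l [MOD orderOf x] :=
      h.of_dvd (orderOf_dvd_of_pow_eq_one (FiniteField.pow_card_sub_one_eq_one x hx))
    rw [← pow_mod_orderOf x k, ← pow_mod_orderOf x l, h2]

/-- power sums vanish for planar functions on the prime field -/
theorem planar_sums (p : ℕ) [Fact p.Prime] (f : ZMod p → ZMod p)
    (hf : ∀ a : ZMod p, a ≠ 0 → Function.Bijective (fun x => f (x + a) - f x)) :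
    ∀ m : ℕ, 2 * m < p - 1 → ∑ x, f x ^ m = 0 := by
  intro m
  induction m using Nat.strong_induction_on with
  | _ m ih =>
  intro hm
  rcases Nat.eq_zero_or_pos m with rfl | hm0
  · simp
  have h1 : ∑ a : ZMod p, ∑ x : ZMod p, (f (x + a) - f x) ^ (2 * m) = 0 := by
    apply Finset.sum_eq_zero
    intro a _
    by_cases ha : a = 0
    · subst ha; simp [hm0.ne']
    · rw [(hf a ha).sum_comp (fun y => y ^ (2 * m))]
      exact FiniteField.sum_pow_lt_card_sub_one _ _ (by rw [ZMod.card]; exact hm)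
  have h2 : ∑ a : ZMod p, ∑ x : ZMod p, (f (x + a) - f x) ^ (2 * m)
      = ∑ x : ZMod p, ∑ y : ZMod p, (f y + - f x) ^ (2 * m) := by
    rw [Finset.sum_comm]
    apply Finset.sum_congr rfl
    intro x _
    have := Equiv.sum_comp (Equiv.addLeft x) (fun y => (f y + - f x) ^ (2 * m))
    rw [← this]
    simp [sub_eq_add_neg]
  have h3 : ∑ x : ZMod p, ∑ y : ZMod p, (f y + - f x) ^ (2 * m)
      = ∑ i ∈ range (2 * m + 1), (-1) ^ (2 * m - i) * ((2 * m).choose i : ZMod p) *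
        ((∑ y, f y ^ i) * (∑ x, f x ^ (2 * m - i))) := by
    simp_rw [add_pow]
    have : ∀ x : ZMod p, ∑ y : ZMod p, ∑ i ∈ range (2 * m + 1),
        f y ^ i * (-f x) ^ (2 * m - i) * ((2 * m).choose i : ZMod p) =
        ∑ i ∈ range (2 * m + 1), (∑ y : ZMod p, f y ^ i) * (-f x) ^ (2 * m - i) * ((2 * m).choose i : ZMod p) := by
      intro x
      rw [Finset.sum_comm]
      simp_rw [Finset.sum_mul]
    simp_rw [this]
    rw [Finset.sum_comm]
    apply Finset.sum_congr rfl
    intro i _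
    rw [Finset.mul_sum, Finset.mul_sum]
    apply Finset.sum_congr rfl
    intro x _
    rw [neg_pow]; ring
  rw [h2, h3, Finset.sum_eq_single m] at h1
  · have e : 2 * m - m = m := by omega
    rw [e] at h1
    have hc : ((2 * m).choose m : ZMod p) ≠ 0 := by
      rw [Ne, ZMod.natCast_eq_zero_iff]
      intro hd
      have hp : p.Prime := Fact.out
      have h5 : p ∣ (2 * m).factorial := by
        rw [← Nat.choose_mul_factorial_mul_factorial (show m ≤ 2 * m by omega)]
        exact Dvd.dvd.mul_right (Dvd.dvd.mul_right hd _) _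
      have := (hp.dvd_factorial).1 h5
      omega
    have hn : ((-1 : ZMod p)) ^ m ≠ 0 := pow_ne_zero _ (by simp)
    have := (mul_eq_zero.1 h1).resolve_left (mul_ne_zero hn hc)
    exact mul_self_eq_zero.1 this
  · intro i hi hne
    rw [mem_range] at hi
    rcases lt_or_gt_of_ne hne with h | h
    · rw [ih i h (by omega)]; ring
    · rw [ih (2 * m - i) (by omega) (by omega)]; ring
  · intro h; exact absurd (mem_range.2 (by omega)) h

theorem no_sol (p : ℕ) [Fact p.Prime] (k : ℕ)
    (hf : ∀ a : ZMod p, a ≠ 0 → Function.Bijective (fun x => (x + a) ^ k - x ^ k))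
    (u v : ℕ) (h : 2 * (u + v) < p - 1) (hpos : 0 < k * u + v) (hd : p - 1 ∣ k * u + v) : False := by
  have hp : p.Prime := Fact.out
  have h1 : ∀ b : ZMod p, ∑ x : ZMod p, (x ^ k + b * x) ^ (u + v) = 0 := by
    intro b
    apply planar_sums p (fun x => x ^ k + b * x) _ _ h
    intro a ha
    have := (hf a ha)
    have h2 := (Equiv.addRight (b * a)).bijective.comp this
    convert h2 using 2 with x
    simp; ring
  let Q : Polynomial (ZMod p) := ∑ i ∈ range (u + v + 1),
    Polynomial.C (((u + v).choose i : ZMod p) * ∑ x : ZMod p, x ^ (k * (u + v - i) + i)) * Polynomial.X ^ i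
  have hQ : ∀ b, Q.eval b = 0 := by
    intro b
    rw [← h1 b]
    simp only [Q, Polynomial.eval_finsetSum, Polynomial.eval_mul, Polynomial.eval_C, Polynomial.eval_pow, Polynomial.eval_X]
    simp_rw [add_comm (_ ^ k) (b * _), add_pow]
    rw [Finset.sum_comm]
    apply Finset.sum_congr rfl
    intro i _
    rw [Finset.mul_sum, Finset.sum_mul]
    apply Finset.sum_congr rfl
    intro x _
    rw [pow_add, pow_mul, mul_pow]; ring
  have hdeg : Q.natDegree < Fintype.card (ZMod p) := by
    rw [ZMod.card]
    apply lt_of_le_of_lt (b := u + v) _ (by omega)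
    apply Polynomial.natDegree_sum_le_of_forall_le
    intro i hi
    rw [mem_range] at hi
    exact (Polynomial.natDegree_C_mul_X_pow_le _ _).trans (by omega)
  have hQ0 : Q = 0 := by
    by_contra hne
    have h4 := Polynomial.card_roots' Q
    have h5 : (Finset.univ : Finset (ZMod p)).card ≤ Q.roots.toFinset.card := by
      apply Finset.card_le_card
      intro b _
      rw [Multiset.mem_toFinset, Polynomial.mem_roots hne]
      exact hQ b
    have h6 := Multiset.toFinset_card_le Q.roots
    rw [Finset.card_univ] at h5
    omega
  have hc : Q.coeff v = 0 := by rw [hQ0]; simp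
  simp only [Q, Polynomial.finsetSum_coeff, Polynomial.coeff_C_mul_X_pow] at hc
  rw [Finset.sum_ite_eq, if_pos (mem_range.2 (by omega))] at hc
  rw [show u + v - v = u by omega, powsum _ hpos, ZMod.card, if_pos hd] at hc
  rw [mul_neg_one, neg_eq_zero, ZMod.natCast_eq_zero_iff] at hc
  have h5 : p ∣ (u + v).factorial := by
    rw [← Nat.choose_mul_factorial_mul_factorial (show v ≤ u + v by omega)]
    exact Dvd.dvd.mul_right (Dvd.dvd.mul_right hc _) _
  have := (hp.dvd_factorial).1 h5
  omega

theorem arith (M k : ℕ) (h2 : 2 < k) (hk : Even k) (hM : Even M) (hkM : k ≤ M) :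
    (∃ i, k * i ≤ M ∧ M < 2 * ((k - 1) * i) ∧ 0 < i) ∨ 2 * k = M + 2 := by
  by_cases hh : 2 * k = M + 2
  · right; exact hh
  left
  have hk4 : 4 ≤ k := by obtain ⟨c, rfl⟩ := hk; omega
  have hy1 : 1 ≤ M / k := (Nat.one_le_div_iff (by omega)).2 hkM
  have e1 := Nat.div_add_mod M k
  have e2 := Nat.mod_lt M (show 0 < k by omega)
  refine ⟨M / k, by omega, ?_, hy1⟩
  obtain ⟨c, rfl⟩ : ∃ c, k = c + 1 := ⟨k - 1, by omega⟩
  generalize M / (c + 1) = y at *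
  generalize M % (c + 1) = r at *
  simp only [Nat.add_sub_cancel]
  rcases Nat.lt_or_ge y 2 with h | h
  · have : y = 1 := by omega
    subst this
    obtain ⟨d, rfl⟩ := hM
    omega
  · nlinarith

theorem prime_case (p : ℕ) [Fact p.Prime] (hodd : Odd p) (k : ℕ) (hk : 0 < k)
    (hf : ∀ a : ZMod p, a ≠ 0 → Function.Bijective (fun x => (x + a) ^ k - x ^ k)) :
    k ≡ 2 [MOD p - 1] := by
  have hp : p.Prime := Fact.out
  have hp3 : 3 ≤ p := by
    have := hp.two_le
    obtain ⟨c, rfl⟩ := hodd; omega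
  obtain ⟨l, hl0, hlM, hl⟩ : ∃ l, 0 < l ∧ l ≤ p - 1 ∧ k ≡ l [MOD p - 1] := by
    by_cases h : k % (p - 1) = 0
    · exact ⟨p - 1, by omega, le_rfl, by simp [Nat.ModEq, h]⟩
    · exact ⟨k % (p - 1), by omega, (Nat.mod_lt _ (by omega)).le, (Nat.mod_modEq _ _).symm⟩
  have hpow : ∀ x : ZMod p, x ^ k = x ^ l := pow_congr k l hk hl0 (by rw [ZMod.card]; exact hl)
  simp_rw [hpow] at hf
  have hM : Even (p - 1) := by obtain ⟨c, rfl⟩ := hodd; simp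
  have inj := (hf 1 one_ne_zero).injective
  have hle : Even l := by
    by_contra ho
    rw [Nat.not_even_iff_odd] at ho
    have : (0 : ZMod p) = -1 := by
      apply inj
      simp [ho.neg_one_pow, hl0.ne']
    simp at this
  refine hl.trans ?_
  rcases Nat.lt_or_ge 2 l with h2 | h2
  swap
  · have : l = 2 := by obtain ⟨c, rfl⟩ := hle; omega
    rw [this]
  exfalso
  rcases arith (p - 1) l h2 hle hM hlM with ⟨i, hi1, hi2, hi0⟩ | hlast
  · apply no_sol p l hf i (p - 1 - l * i)
    · obtain ⟨c, rfl⟩ : ∃ c, l = c + 1 := ⟨l - 1, by omega⟩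
      simp only [Nat.add_sub_cancel] at hi2
      rw [add_mul] at *
      omega
    · have : l * i + (p - 1 - l * i) = p - 1 := by omega
      omega
    · have : l * i + (p - 1 - l * i) = p - 1 := by omega
      rw [this]
  · have hl4 : 4 ≤ l := by obtain ⟨c, rfl⟩ := hle; omega
    have hp7 : 7 ≤ p := by omega
    have h3 : (3 : ZMod p) ≠ 0 := by
      intro h
      have : ((3 : ℕ) : ZMod p) = 0 := by exact_mod_cast h
      rw [ZMod.natCast_eq_zero_iff] at this
      have := Nat.le_of_dvd (by norm_num) this
      omega
    have h2' : (2 : ZMod p) ≠ 0 := by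
      intro h
      have : ((2 : ℕ) : ZMod p) = 0 := by exact_mod_cast h
      rw [ZMod.natCast_eq_zero_iff] at this
      have := Nat.le_of_dvd (by norm_num) this
      omega
    have key : ∀ x : ZMod p, x ≠ 0 → x ^ l = x ∨ x ^ l = - x := by
      intro x hx
      have : (x ^ l) ^ 2 = x ^ 2 := by
        rw [← pow_mul, mul_comm, hlast, pow_add, ZMod.pow_card_sub_one_eq_one hx, one_mul]
      exact sq_eq_sq_iff_eq_or_eq_neg.1 this
    have i01 := @inj 0 1
    have i03 := @inj 0 3
    have i2 := @inj 2 (-1)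
    simp only [zero_add, one_pow, zero_pow hl0.ne', sub_zero, hle.neg_one_pow, neg_add_cancel, zero_sub] at i01 i03 i2
    have e4 : (4 : ZMod p) ^ l = 4 := by
      have : (4 : ZMod p) = 2 * 2 := by norm_num
      rw [this, mul_pow]
      rcases key 2 h2' with h | h <;> rw [h] <;> ring
    norm_num at i01 i03 i2
    rcases key 2 h2' with h | h
    · rw [h] at i01; apply i01; norm_num
    · rcases key 3 h3 with h' | h'
      · rw [h', e4] at i03
        exact h3 (i03 (by norm_num)).symm
      · rw [h, h'] at i2
        have := i2 (by norm_num)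
        apply h3
        linear_combination this

theorem mixed_sum (p : ℕ) (hp : p.Prime) (hp5 : 5 ≤ p) (F : Type*) [Field F] [Fintype F]
    [CharP F p] (hF : Fintype.card F = p ^ 2) (a b : ℕ) (ha : 2 ≤ a) (hb : 2 ≤ b)
    (hab : a + b = p + 1) :
    ∑ x : F, x ^ (p * (a + b * p)) * (x + 1) ^ (a + b * p)
      = - ((a.choose 2 : F) * (b.choose 2 : F)) := by
  haveI : Fact p.Prime := ⟨hp⟩
  have hfrob : ∀ x : F, x ^ (p * p) = x := by
    intro x
    have := FiniteField.pow_card x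
    rwa [hF, sq] at this
  have h1 : ∀ x : F, x ^ (p * (a + b * p)) * (x + 1) ^ (a + b * p) =
      ∑ i ∈ range (a + 1), ∑ j ∈ range (b + 1),
        ((a.choose i : F) * (b.choose j : F)) * x ^ (b + i + p * (a + j)) := by
    intro x
    have e1 : x ^ (p * (a + b * p)) = x ^ (b + p * a) := by
      rw [show p * (a + b * p) = (p * p) * b + p * a by ring, pow_add, pow_mul, hfrob, ← pow_add]
    have e2 : (x + 1) ^ (a + b * p) = (x + 1) ^ a * (x ^ p + 1) ^ b := by
      rw [pow_add, mul_comm b p, pow_mul (x + 1) p b, add_pow_char x 1 p, one_pow]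
    rw [e1, e2, add_pow, add_pow, Finset.sum_mul_sum, Finset.mul_sum]
    apply Finset.sum_congr rfl
    intro i _
    rw [Finset.mul_sum]
    apply Finset.sum_congr rfl
    intro j _
    simp only [one_pow, mul_one]
    rw [← pow_mul]
    rw [show b + i + p * (a + j) = (b + p * a) + i + p * j by ring, pow_add, pow_add]
    ring
  simp_rw [h1]
  rw [Finset.sum_comm]
  have h2 : ∀ i ∈ range (a + 1), ∑ x : F, ∑ j ∈ range (b + 1),
        ((a.choose i : F) * (b.choose j : F)) * x ^ (b + i + p * (a + j)) =
      ∑ j ∈ range (b + 1), ((a.choose i : F) * (b.choose j : F)) *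
        (if p ^ 2 - 1 ∣ b + i + p * (a + j) then -1 else 0) := by
    intro i _
    rw [Finset.sum_comm]
    apply Finset.sum_congr rfl
    intro j _
    rw [← Finset.mul_sum, powsum _ (by omega), hF]
  rw [Finset.sum_congr rfl h2]
  have h3 : ∀ i ∈ range (a + 1), ∀ j ∈ range (b + 1),
      (p ^ 2 - 1 ∣ b + i + p * (a + j)) → i = a - 2 ∧ j = b - 2 := by
    intro i hi j hj hd
    rw [mem_range] at hi hj
    obtain ⟨c, hc⟩ := hd
    have hpp : p ^ 2 - 1 + 1 = p ^ 2 := Nat.sub_add_cancel (Nat.one_le_pow _ _ (by omega))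
    generalize p ^ 2 - 1 = N at *
    have hc1 : c = 1 := by
      have : 0 < c := by
        rcases Nat.eq_zero_or_pos c with rfl | h
        · omega
        · exact h
      have : c < 2 := by
        by_contra hcc
        have h8 : N * 2 ≤ N * c := Nat.mul_le_mul_left _ (by omega)
        have h9 : p * (a + j) ≤ p * (p + 1) := Nat.mul_le_mul_left _ (by omega)
        nlinarith
      omega
    subst hc1
    have h10 : b + i + 1 + p * (a + j) = p * p := by nlinarith
    have h11 : p ∣ b + i + 1 := by
      rw [Nat.dvd_add_iff_left (Dvd.intro (a + j) rfl), h10]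
      exact Dvd.intro _ rfl
    obtain ⟨d, hd⟩ := h11
    have hd1 : d = 1 := by
      have : 0 < d := by
        rcases Nat.eq_zero_or_pos d with rfl | h
        · omega
        · exact h
      have : d < 2 := by
        by_contra hcc
        have h8 : p * 2 ≤ p * d := Nat.mul_le_mul_left _ (by omega)
        omega
      omega
    subst hd1
    have h12 : p * (1 + (a + j)) = p * p := by rw [← h10, hd]; ring
    have h13 := Nat.eq_of_mul_eq_mul_left (by omega) h12
    omega
  rw [Finset.sum_eq_single (a - 2), Finset.sum_eq_single (b - 2)]
  · rw [if_pos, Nat.choose_symm ha, Nat.choose_symm hb]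
    · ring
    · have : b + (a - 2) + p * (a + (b - 2)) = p ^ 2 - 1 := by
        have e1 : b + (a - 2) = p - 1 := by omega
        have e2 : a + (b - 2) = p - 1 := by omega
        rw [e1, e2]
        obtain ⟨c, rfl⟩ : ∃ c, p = c + 1 := ⟨p - 1, by omega⟩
        simp only [Nat.add_sub_cancel]
        have : (c + 1) ^ 2 = c + (c + 1) * c + 1 := by ring
        omega
      rw [this]
  · intro j hj hne
    rw [if_neg, mul_zero]
    intro hd
    exact hne (h3 _ (mem_range.2 (by omega)) j hj hd).2
  · intro h; exact absurd (mem_range.2 (by omega)) h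
  · intro i hi hne
    apply Finset.sum_eq_zero
    intro j hj
    rw [if_neg, mul_zero]
    intro hd
    exact hne (h3 i hi j hj hd).1
  · intro h; exact absurd (mem_range.2 (by omega)) h

theorem choose_two_ne (p : ℕ) (hp : p.Prime) (F : Type*) [Field F] [CharP F p] (a : ℕ)
    (ha : 2 ≤ a) (hap : a < p) : (a.choose 2 : F) ≠ 0 := by
  rw [Ne, CharP.cast_eq_zero_iff F p]
  intro hd
  have h5 : p ∣ a.factorial := by
    rw [← Nat.choose_mul_factorial_mul_factorial ha]
    exact Dvd.dvd.mul_right (Dvd.dvd.mul_right hd _) _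
  have := (hp.dvd_factorial).1 h5
  omega

theorem stmt_10 (p : ℕ) (hp : p.Prime) (hodd : Odd p) (k : ℕ) (hk : 0 < k)
    (F : Type*) [Field F] [Fintype F] (hF : Fintype.card F = p ^ 2) :
    (∀ a : F, a ≠ 0 → Function.Bijective (fun x : F => (x + a) ^ k - x ^ k)) ↔
      (k ≡ 2 [MOD p ^ 2 - 1] ∨ k ≡ 2 * p [MOD p ^ 2 - 1]) := by
  haveI : Fact p.Prime := ⟨hp⟩
  haveI : CharP F p := charP_of_card_eq_prime_pow hF
  have hp3 : 3 ≤ p := by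
    have := hp.two_le
    obtain ⟨c, rfl⟩ := hodd; omega
  have h2ne : (2 : F) ≠ 0 := by
    intro h
    have h' : ((2 : ℕ) : F) = 0 := by exact_mod_cast h
    rw [CharP.cast_eq_zero_iff F p] at h'
    have := Nat.le_of_dvd (by norm_num) h'
    omega
  have hfac : p ^ 2 - 1 = (p + 1) * (p - 1) := by
    simpa using Nat.sq_sub_sq p 1
  have hN : p ^ 2 - 1 + 1 = p ^ 2 := Nat.sub_add_cancel (Nat.one_le_pow _ _ (by omega))
  have hfrob : ∀ x : F, x ^ (p * p) = x := by
    intro x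
    have := FiniteField.pow_card x
    rwa [hF, sq] at this
  constructor
  · intro hf
    -- prime field
    have hprime : k ≡ 2 [MOD p - 1] := by
      apply prime_case p hodd k hk
      intro a ha
      rw [← Finite.injective_iff_bijective]
      intro x y hxy
      let φ := ZMod.castHom (dvd_refl p) F
      have hφ : Function.Injective φ := φ.injective
      apply hφ
      apply (hf (φ a) (by rwa [Ne, map_eq_zero])).injective
      have := congrArg φ hxy
      simpa using this
    -- not divisible by p + 1
    have hnd : ¬ (p + 1 ∣ k) := by
      rintro ⟨c, rfl⟩
      have hfix : ∀ y : F, y ^ p = y := by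
        intro y
        obtain ⟨x, rfl⟩ := (hf 1 one_ne_zero).surjective y
        have hx : ∀ z : F, (z ^ ((p + 1) * c)) ^ p = z ^ ((p + 1) * c) := by
          intro z
          rw [← pow_mul, show (p + 1) * c * p = (p * p) * c + p * c by ring, pow_add, pow_mul, hfrob,
            ← pow_add]
          ring_nf
        simp only
        rw [sub_pow_char, hx, hx]
      have hs := powsum (F := F) (p - 1 + (p ^ 2 - 1)) (by omega)
      have h0 : (Polynomial.X ^ p - Polynomial.X : Polynomial F) ≠ 0 :=
        FiniteField.X_pow_card_sub_X_ne_zero F hp.one_lt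
      have h4 := Polynomial.card_roots' (Polynomial.X ^ p - Polynomial.X : Polynomial F)
      rw [FiniteField.X_pow_card_sub_X_natDegree_eq F hp.one_lt] at h4
      classical
      have h5 : (Finset.univ : Finset F).card ≤
          (Polynomial.X ^ p - Polynomial.X : Polynomial F).roots.toFinset.card := by
        apply Finset.card_le_card
        intro b _
        rw [Multiset.mem_toFinset, Polynomial.mem_roots h0]
        simp [hfix b]
      have h6 := Multiset.toFinset_card_le (Polynomial.X ^ p - Polynomial.X : Polynomial F).roots
      rw [Finset.card_univ, hF] at h5
      nlinarith
    have hk0 : k % (p ^ 2 - 1) < p ^ 2 - 1 := Nat.mod_lt _ (by nlinarith)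
    obtain ⟨l, hl⟩ : ∃ l, l = k % (p ^ 2 - 1) := ⟨_, rfl⟩
    have hkl : k ≡ l [MOD p ^ 2 - 1] := by rw [hl]; exact (Nat.mod_modEq _ _).symm
    rw [← hl] at hk0
    have hnl : ¬ (p + 1 ∣ l) := by
      intro h
      apply hnd
      exact ((hkl.of_dvd (by rw [hfac]; exact Dvd.intro _ rfl)).dvd_iff dvd_rfl).2 h
    have hl2 : l ≡ 2 [MOD p - 1] :=
      (hkl.of_dvd (by rw [hfac]; exact Dvd.intro_left _ rfl)).symm.trans hprime
    obtain ⟨a, b, hap, hbp, hlab⟩ : ∃ a b, a < p ∧ b < p ∧ l = a + b * p := by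
      refine ⟨l % p, l / p, Nat.mod_lt _ (by omega), ?_, ?_⟩
      · rw [Nat.div_lt_iff_lt_mul (by omega)]; nlinarith
      · have := Nat.mod_add_div l p
        nlinarith
    subst hlab
    have hab : a + b ≡ 2 [MOD p - 1] := by
      refine Nat.ModEq.trans ?_ hl2
      apply Nat.ModEq.add_left
      have : p ≡ 1 [MOD p - 1] := by
        have := Nat.add_modEq_left (n := p - 1) (a := 1)
        rwa [show p - 1 + 1 = p by omega] at this
      simpa using (this.mul_left b).symm
    have hcases : a + b = 0 ∨ a + b = 2 ∨ (a + b = p + 1) := by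
      have h7 : ((p - 1 : ℕ) : ℤ) ∣ ((2 : ℕ) : ℤ) - ((a + b : ℕ) : ℤ) := hab.dvd
      obtain ⟨c, hc⟩ := h7
      rw [Nat.cast_sub (by omega)] at hc
      push_cast at hc
      have hpz : (3 : ℤ) ≤ p := by exact_mod_cast hp3
      have ha' : (a : ℤ) + 1 ≤ p := by exact_mod_cast hap
      have hb' : (b : ℤ) + 1 ≤ p := by exact_mod_cast hbp
      have ha0 : (0 : ℤ) ≤ a := by positivity
      have hb0 : (0 : ℤ) ≤ b := by positivity
      have c1 : -2 < c := by
        by_contra h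
        have : c ≤ -2 := by omega
        nlinarith
      have c2 : c ≤ 1 := by
        by_contra h
        have : 2 ≤ c := by omega
        nlinarith
      have : c = -1 ∨ c = 0 ∨ c = 1 := by omega
      rcases this with rfl | rfl | rfl <;> omega
    rcases hcases with h0 | h2 | hp1
    · exfalso; apply hnl
      have : a = 0 := by omega
      have : b = 0 := by omega
      subst a b; simp
    · have : a = 0 ∧ b = 2 ∨ a = 1 ∧ b = 1 ∨ a = 2 ∧ b = 0 := by omega
      rcases this with ⟨rfl, rfl⟩ | ⟨rfl, rfl⟩ | ⟨rfl, rfl⟩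
      · right; simpa using hkl
      · exfalso; apply hnl; simp [add_comm]
      · left; simpa using hkl
    · exfalso
      have hp5 : 5 ≤ p := by
        by_contra h
        have : p = 3 := by obtain ⟨c, rfl⟩ := hodd; omega
        subst this
        have : a = 2 := by omega
        have : b = 2 := by omega
        subst a b
        norm_num at hk0
      have hpow : ∀ x : F, x ^ k = x ^ (a + b * p) :=
        pow_congr k _ hk (by omega) (by rw [hF]; exact hkl)
      simp_rw [hpow] at hf
      have hA := mixed_sum p hp hp5 F hF a b (by omega) (by omega) hp1
      have hsum : ∑ x : F, ((x + 1) ^ (a + b * p) - x ^ (a + b * p)) ^ (p + 1) = 0 := by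
        rw [(hf 1 one_ne_zero).sum_comp (fun y => y ^ (p + 1))]
        apply FiniteField.sum_pow_lt_card_sub_one
        rw [hF, hfac]
        have : 2 ≤ p - 1 := by omega
        nlinarith
      have hnorm : ∑ x : F, x ^ ((a + b * p) * (p + 1)) = 0 := by
        rw [powsum _ (Nat.mul_pos (by omega) (by omega)), hF, hfac, if_neg]
        rw [mul_comm (a + b * p), Nat.mul_dvd_mul_iff_left (by omega)]
        intro h
        have := (hl2.dvd_iff dvd_rfl).1 h
        have := Nat.le_of_dvd (by norm_num) this
        omega
      have hnorm' : ∑ x : F, (x + 1) ^ ((a + b * p) * (p + 1)) = 0 := by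
        rw [← hnorm]
        exact Equiv.sum_comp (Equiv.addRight (1 : F)) (fun y => y ^ ((a + b * p) * (p + 1)))
      have hB : ∑ x : F, x ^ (a + b * p) * (x + 1) ^ (p * (a + b * p))
          = (∑ x : F, x ^ (p * (a + b * p)) * (x + 1) ^ (a + b * p)) ^ p := by
        rw [sum_pow_char]
        apply Finset.sum_congr rfl
        intro x _
        rw [mul_pow, ← pow_mul, ← pow_mul,
          show p * (a + b * p) * p = (p * p) * (a + b * p) by ring, pow_mul x (p * p), hfrob,
          mul_comm (a + b * p) p]
      have hC : (∑ x : F, x ^ (p * (a + b * p)) * (x + 1) ^ (a + b * p)) ^ p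
          = - ((a.choose 2 : F) * (b.choose 2 : F)) := by
        rw [hA, hodd.neg_pow, mul_pow]
        have : ∀ n : ℕ, ((n : F)) ^ p = n := by
          intro n
          have := map_natCast (frobenius F p) n
          rwa [frobenius_def] at this
        rw [this, this]
      have hexp : ∀ x : F, ((x + 1) ^ (a + b * p) - x ^ (a + b * p)) ^ (p + 1) =
          (x + 1) ^ ((a + b * p) * (p + 1)) + x ^ ((a + b * p) * (p + 1))
          - x ^ (p * (a + b * p)) * (x + 1) ^ (a + b * p)
          - x ^ (a + b * p) * (x + 1) ^ (p * (a + b * p)) := by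
        intro x
        rw [pow_succ, sub_pow_char, ← pow_mul, ← pow_mul, mul_comm p (a + b * p),
          mul_add, mul_one, pow_add _ _ (a + b * p), pow_add _ _ (a + b * p)]
        ring
      simp_rw [hexp] at hsum
      rw [Finset.sum_sub_distrib, Finset.sum_sub_distrib, Finset.sum_add_distrib, hnorm, hnorm',
        hB, hC, hA] at hsum
      have ha := choose_two_ne p hp F a (by omega) hap
      have hb := choose_two_ne p hp F b (by omega) hbp
      have : (2 : F) * ((a.choose 2 : F) * (b.choose 2 : F)) = 0 := by
        linear_combination hsum
      exact mul_ne_zero h2ne (mul_ne_zero ha hb) this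
  · intro h a ha
    rw [← Finite.injective_iff_bijective]
    have h2 : Function.Injective (fun x : F => (x + a) ^ 2 - x ^ 2) := by
      intro x y hxy
      simp only at hxy
      have : (2 * a) * (x - y) = 0 := by linear_combination hxy
      have := (mul_eq_zero.1 this).resolve_left (mul_ne_zero h2ne ha)
      exact sub_eq_zero.1 this
    rcases h with h | h
    · have hpow : ∀ x : F, x ^ k = x ^ 2 :=
        pow_congr k 2 hk (by omega) (by rw [hF]; exact h)
      simp_rw [hpow]
      exact h2
    · have hpow : ∀ x : F, x ^ k = (x ^ 2) ^ p := by
        intro x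
        rw [← pow_mul]
        exact pow_congr k (2 * p) hk (by omega) (by rw [hF]; exact h) x
      simp_rw [hpow, ← sub_pow_char]
      exact (frobenius_inj F p).comp h2
end

section
/- Let p be an odd prime and k a positive integer. Then the monomial X^k is planar over the finite field with p^3 elements if and only if there exist i, j ∈ {0, 1, 2} such that k ≡ p^i + p^j (mod p^3 − 1). -/
open NumberField
lemma pm_ring_aux (p : ℕ) (hp : p.Prime) (K : Type) [Field K] [NumberField K]
    [NeZero p] [IsCyclotomicExtension {p} ℚ K] :
    ∃ (R : Type) (_ : CommRing R) (_ : IsDomain R) (ζ : R) (σ : R ≃+* R),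
      Prime (ζ - 1) ∧ ζ ^ p = 1 ∧ Associated ((ζ - 1) ^ (p - 1)) (p : R) ∧ ζ * σ ζ = 1 := by
  have : Fact p.Prime := ⟨hp⟩
  have hζ : IsPrimitiveRoot (IsCyclotomicExtension.zeta p ℚ K) p :=
    IsCyclotomicExtension.zeta_spec p ℚ K
  let σ : K ≃ₐ[ℚ] K := IsCyclotomicExtension.fromZetaAut (n := p) hζ.inv
    (Polynomial.cyclotomic.irreducible_rat hp.pos)
  have hσ : σ (IsCyclotomicExtension.zeta p ℚ K) = (IsCyclotomicExtension.zeta p ℚ K)⁻¹ :=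
    IsCyclotomicExtension.fromZetaAut_spec _ _
  refine ⟨𝓞 K, inferInstance, inferInstance, hζ.toInteger,
    RingOfIntegers.mapRingEquiv σ.toRingEquiv, hζ.zeta_sub_one_prime', ?_, ?_, ?_⟩
  · exact hζ.toInteger_isPrimitiveRoot.pow_eq_one
  · exact IsCyclotomicExtension.Rat.associated_zeta_sub_one_pow_prime p hζ
  · apply RingOfIntegers.ext
    have h0 : IsCyclotomicExtension.zeta p ℚ K ≠ 0 := hζ.ne_zero hp.ne_zero
    change IsCyclotomicExtension.zeta p ℚ K * σ (IsCyclotomicExtension.zeta p ℚ K) = 1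
    rw [hσ, mul_inv_cancel₀ h0]

lemma pm_ring (p : ℕ) (hp : p.Prime) :
    ∃ (R : Type) (_ : CommRing R) (_ : IsDomain R) (ζ : R) (σ : R ≃+* R),
      Prime (ζ - 1) ∧ ζ ^ p = 1 ∧ Associated ((ζ - 1) ^ (p - 1)) (p : R) ∧ ζ * σ ζ = 1 := by
  have : NeZero p := ⟨hp.ne_zero⟩
  have : NeZero ((p : ℕ) : ℚ) := ⟨by exact_mod_cast hp.ne_zero⟩
  have h2 := CyclotomicField.isCyclotomicExtension p ℚ
  have : IsCyclotomicExtension {p} ℚ (CyclotomicField p ℚ) := by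
    convert! h2
  exact pm_ring_aux p hp (CyclotomicField p ℚ)

/-- In the ring above, `S * σ S = p ^ 3` forces `S` to be divisible by `(ζ - 1) ^ (3 (p - 1) / 2)`. -/
lemma pm_half {R : Type} [CommRing R] [IsDomain R] {p h : ℕ} (hph : p = 2 * h + 1) {ζ : R}
    {σ : R ≃+* R} (hpr : Prime (ζ - 1)) (has : Associated ((ζ - 1) ^ (p - 1)) (p : R))
    (hσ : ζ * σ ζ = 1) {S : R} (hS : S * σ S = (p : R) ^ 3) : (ζ - 1) ^ (3 * h) ∣ S := by
  set P := ζ - 1 with hP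
  have hdiv : P ^ (6 * h) ∣ S * σ S := by
    rw [hS]
    have := (has.pow_pow (n := 3)).dvd
    rwa [← pow_mul, show (p - 1) * 3 = 6 * h by omega] at this
  have hσP : σ P = -(σ ζ) * P := by
    rw [hP, map_sub, map_one]; linear_combination hσ
  have hu : IsUnit (σ ζ) := IsUnit.of_mul_eq_one ζ (by rw [mul_comm]; exact hσ)
  by_contra hcon
  -- write S = P^m * s
  have hex : ∃ m, m < 3 * h ∧ ∃ s, S = P ^ m * s ∧ ¬ P ∣ s := by
    classical
    have hne : ∃ n, ¬ P ^ n ∣ S := ⟨_, hcon⟩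
    have hn := Nat.find_spec hne
    have hpos : Nat.find hne ≠ 0 := by
      intro h0; rw [h0] at hn; simp at hn
    obtain ⟨m, hm⟩ := Nat.exists_eq_succ_of_ne_zero hpos
    have hlt : m < Nat.find hne := by omega
    have hd : P ^ m ∣ S := not_not.mp (Nat.find_min hne hlt)
    obtain ⟨s, hs⟩ := hd
    refine ⟨m, ?_, s, hs, ?_⟩
    · have := Nat.find_min' hne hcon
      omega
    · rintro ⟨t, rfl⟩
      apply hn
      rw [hm, hs]
      exact ⟨t, by rw [Nat.succ_eq_add_one, pow_succ]; ring⟩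
  obtain ⟨m, hm, s, rfl, hs⟩ := hex
  have hσs : ¬ P ∣ σ s := by
    rintro ⟨t, ht⟩
    apply hs
    have h1 : s = σ.symm P * σ.symm t := by
      rw [← map_mul, ← ht, RingEquiv.symm_apply_apply]
    have h2 : P = σ.symm (-(σ ζ)) * σ.symm P := by
      rw [← map_mul, ← hσP, RingEquiv.symm_apply_apply]
    have h3 : IsUnit (σ.symm (-(σ ζ))) := (hu.neg).map σ.symm
    obtain ⟨u, hu'⟩ := h3
    rw [← hu'] at h2
    rw [h1]
    apply Dvd.dvd.mul_right
    have h6 : P ∣ (↑u⁻¹ : R) * P := dvd_mul_left _ _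
    have h7 : (↑u⁻¹ : R) * P = σ.symm P := by
      have h8 : (↑u⁻¹ : R) * P = (↑u⁻¹ : R) * (u * σ.symm P) := congrArg _ h2
      rw [h8, ← mul_assoc]
      simp
    rwa [h7] at h6
  have e1 : P ^ m * s * σ (P ^ m * s) = P ^ (2 * m) * ((-(σ ζ)) ^ m * (s * σ s)) := by
    rw [map_mul, map_pow, hσP, mul_pow]
    generalize (-(σ ζ)) ^ m = y
    ring
  rw [e1, show 6 * h = 2 * m + (6 * h - 2 * m - 1 + 1) by omega, pow_add] at hdiv
  have hP0 : P ^ (2 * m) ≠ 0 := pow_ne_zero _ hpr.ne_zero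
  have := (mul_dvd_mul_iff_left hP0).mp hdiv
  rw [pow_succ] at this
  have h4 : P ∣ (-(σ ζ)) ^ m * (s * σ s) := (dvd_mul_left _ _).trans this
  rcases hpr.dvd_or_dvd h4 with h5 | h5
  · exact hpr.not_isUnit (isUnit_of_dvd_unit h5 ((hu.neg).pow m))
  · rcases hpr.dvd_or_dvd h5 with h6 | h6
    · exact hs h6
    · exact hσs h6

lemma pm_char_ne {R : Type} [CommRing R] {p : ℕ} (hp : p.Prime) [NeZero p] {ζ : R}
    (hpr : Prime (ζ - 1)) (hζ : ζ ^ p = 1) {c : ZMod p} (hc : c ≠ 0) :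
    AddChar.zmodChar p hζ c ≠ 1 := by
  intro h
  rw [AddChar.zmodChar_apply] at h
  have h1 : orderOf ζ ∣ c.val := orderOf_dvd_of_pow_eq_one h
  have h2 : orderOf ζ ∣ p := orderOf_dvd_of_pow_eq_one hζ
  rcases (Nat.dvd_prime hp).mp h2 with h3 | h3
  · rw [orderOf_eq_one_iff] at h3
    exact hpr.ne_zero (by rw [h3, sub_self])
  · rw [h3] at h1
    have h4 := ZMod.val_lt c
    have h5 : c.val ≠ 0 := by rwa [Ne, ZMod.val_eq_zero]
    exact absurd (Nat.le_of_dvd (Nat.pos_of_ne_zero h5) h1) (by omega)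

lemma pm_sum_zero {R : Type} [CommRing R] [IsDomain R] {p : ℕ} (hp : p.Prime) [NeZero p] {ζ : R}
    (hpr : Prime (ζ - 1)) (hζ : ζ ^ p = 1) {F : Type*} [AddCommGroup F] [Fintype F]
    (l : F →+ ZMod p) (hl : l ≠ 0) : ∑ x, AddChar.zmodChar p hζ (l x) = 0 := by
  have h : ∑ x, ((AddChar.zmodChar p hζ).compAddMonoidHom l) x = 0 := by
    classical
    rw [AddChar.sum_eq_ite, if_neg]
    intro h0
    apply hl
    ext x
    by_contra hx
    apply pm_char_ne hp hpr hζ hx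
    have := DFunLike.congr_fun h0 x
    simpa using this
  simpa using h

lemma pm_S_dvd {R : Type} [CommRing R] [IsDomain R] {p h : ℕ} (hp : p.Prime) [NeZero p]
    (hph : p = 2 * h + 1) {ζ : R}
    {σ : R ≃+* R} (hpr : Prime (ζ - 1)) (has : Associated ((ζ - 1) ^ (p - 1)) (p : R))
    (hζ : ζ ^ p = 1) (hσ : ζ * σ ζ = 1) {F : Type*} [Field F] [Fintype F]
    (hF : Fintype.card F = p ^ 3) (f : F → F)
    (hf : ∀ a : F, a ≠ 0 → Function.Bijective (fun x : F => f (x + a) - f x))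
    (l m : F →+ ZMod p) :
    (ζ - 1) ^ (3 * h) ∣ ∑ x, AddChar.zmodChar p hζ (l x + m (f x)) := by
  classical
  set χ := AddChar.zmodChar p hζ with hχ
  have hq : (ζ - 1) ^ (3 * h) ∣ (p : R) ^ 3 := by
    have := (has.pow_pow (n := 3)).dvd
    rw [← pow_mul] at this
    exact (pow_dvd_pow _ (by omega)).trans this
  by_cases hm : m = 0
  · subst hm
    by_cases hl : l = 0
    · subst hl
      simpa [hF] using hq
    · have := pm_sum_zero hp hpr hζ l hl
      simp only [AddMonoidHom.zero_apply, add_zero]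
      rw [this]
      exact dvd_zero _
  · apply pm_half hph hpr has hσ
    have hσχ : ∀ c, σ (χ c) = χ (-c) := by
      intro c
      have h1 : χ c * χ (-c) = 1 := by rw [← AddChar.map_add_eq_mul]; simp
      have h2 : χ c * σ (χ c) = 1 := by
        rw [hχ, AddChar.zmodChar_apply, map_pow, ← mul_pow, hσ, one_pow]
      calc σ (χ c) = (χ c * χ (-c)) * σ (χ c) := by rw [h1, one_mul]
        _ = (χ c * σ (χ c)) * χ (-c) := by ring
        _ = χ (-c) := by rw [h2, one_mul]
    rw [map_sum, Finset.sum_mul_sum, Finset.sum_comm]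
    calc ∑ y, ∑ x, χ (l x + m (f x)) * σ (χ (l y + m (f y)))
        = ∑ y, ∑ a, χ (l a) * χ (m (f (y + a) - f y)) := by
          refine Finset.sum_congr rfl fun y _ => ?_
          rw [← Equiv.sum_comp (Equiv.addLeft y)]
          refine Finset.sum_congr rfl fun a _ => ?_
          rw [hσχ, ← AddChar.map_add_eq_mul, ← AddChar.map_add_eq_mul]
          congr 1
          simp only [Equiv.coe_addLeft, map_add, map_sub]
          ring
      _ = ∑ a, χ (l a) * ∑ y, χ (m (f (y + a) - f y)) := by
          rw [Finset.sum_comm]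
          simp_rw [Finset.mul_sum]
      _ = ∑ a : F, if a = 0 then (p : R) ^ 3 else 0 := by
          refine Finset.sum_congr rfl fun a _ => ?_
          split_ifs with ha
          · subst ha; simp [hF]
          · have := (Equiv.ofBijective _ (hf a ha)).sum_comp (fun z => χ (m z))
            simp only [Equiv.ofBijective_apply] at this
            rw [this, pm_sum_zero hp hpr hζ m hm, mul_zero]
      _ = _ := by simp

lemma pm_int_dvd {R : Type} [CommRing R] {p : ℕ} (hp : p.Prime) {P : R}
    (hpr : Prime P) (hPp : P ∣ (p : R)) {n : ℕ} (h : P ∣ (n : R)) : p ∣ n := by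
  by_contra hn
  have hc : IsCoprime (p : ℤ) (n : ℤ) :=
    Nat.isCoprime_iff_coprime.mpr ((Nat.Prime.coprime_iff_not_dvd hp).mpr hn)
  obtain ⟨u, v, huv⟩ := hc
  have : (1 : R) = (u : R) * p + v * n := by
    exact_mod_cast (congrArg (fun z : ℤ => (z : R)) huv).symm
  apply hpr.not_isUnit
  apply isUnit_of_dvd_one
  rw [this]
  exact dvd_add (hPp.mul_left _) (h.mul_left _)

/-- Low degree moments vanish. -/
lemma pm_moment {p h : ℕ} (hp : p.Prime) (hph : p = 2 * h + 1)
    {F : Type*} [Field F] [Fintype F]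
    (hF : Fintype.card F = p ^ 3) (f : F → F)
    (hf : ∀ a : F, a ≠ 0 → Function.Bijective (fun x : F => f (x + a) - f x))
    {ι : Type*} [Fintype ι] (hι : Fintype.card ι < 3 * h) (l m : ι → F →+ ZMod p) :
    ∑ x, ∏ s, (l s x + m s (f x)) = 0 := by
  classical
  obtain ⟨R, _, _, ζ, σ, hpr, hζ, has, hσ⟩ := pm_ring p hp
  have : NeZero p := ⟨hp.ne_zero⟩
  set χ := AddChar.zmodChar p hζ with hχ
  have h1 : (ζ - 1) ^ (3 * h) ∣ ∑ x, ∏ s, (χ (l s x + m s (f x)) - 1) := by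
    simp_rw [Finset.prod_sub]
    rw [Finset.sum_comm]
    apply Finset.dvd_sum
    intro T' _
    have : ∀ (T : Finset ι) (x : F), (∏ s ∈ T, χ (l s x + m s (f x)))
        = χ ((∑ s ∈ T, l s) x + (∑ s ∈ T, m s) (f x)) := by
      intro T x
      simp only [AddMonoidHom.finsetSum_apply, ← Finset.sum_add_distrib]
      induction T using Finset.induction_on with
      | empty => simp
      | insert s T hs ih =>
        rw [Finset.prod_insert hs, Finset.sum_insert hs, ih, AddChar.map_add_eq_mul χ (_ + _)]
    simp only [this, Finset.prod_const_one, mul_one]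
    rw [← Finset.mul_sum]
    exact (pm_S_dvd hp hph hpr has hζ hσ hF f hf _ _).mul_left _
  have hPp : (ζ - 1) ∣ (p : R) :=
    (dvd_pow_self _ (by have := hp.two_le; omega)).trans has.dvd
  set g : ZMod p → R := fun c => ∑ i ∈ Finset.range c.val, ζ ^ i with hg
  have hgc : ∀ c, χ c - 1 = (ζ - 1) * g c := by
    intro c
    rw [hχ, AddChar.zmodChar_apply, hg, mul_geom_sum]
  have hgn : ∀ c, (ζ - 1) ∣ g c - (c.val : R) := by
    intro c
    have : g c - (c.val : R) = ∑ i ∈ Finset.range c.val, (ζ ^ i - 1) := by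
      simp [hg]
    rw [this]
    exact Finset.dvd_sum fun i _ => sub_one_dvd_pow_sub_one ζ i
  simp_rw [hgc, Finset.prod_mul_distrib, Finset.prod_const, ← Finset.mul_sum] at h1
  rw [Finset.card_univ, show 3 * h = Fintype.card ι + (3 * h - Fintype.card ι - 1 + 1) by omega,
    pow_add] at h1
  have h2 := (mul_dvd_mul_iff_left (pow_ne_zero _ hpr.ne_zero)).mp h1
  have h3 : (ζ - 1) ∣ ∑ x, ∏ s, g (l s x + m s (f x)) :=
    (dvd_pow_self _ (by omega)).trans h2
  have h4 : (ζ - 1) ∣ ((∑ x, ∏ s, (l s x + m s (f x)).val : ℕ) : R) := by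
    rw [← Ideal.mem_span_singleton, ← Ideal.Quotient.eq_zero_iff_mem] at h3 ⊢
    rw [← h3]
    push_cast
    simp only [map_sum, map_prod]
    refine Finset.sum_congr rfl fun x _ => Finset.prod_congr rfl fun s _ => ?_
    rw [eq_comm, Ideal.Quotient.eq, Ideal.mem_span_singleton]
    exact hgn _
  have h5 := pm_int_dvd hp hpr hPp h4
  rw [← ZMod.natCast_eq_zero_iff] at h5
  rw [← h5]
  push_cast
  simp

lemma pm_moment2 {p h : ℕ} (hp : p.Prime) (hph : p = 2 * h + 1)
    {F : Type*} [Field F] [Fintype F]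
    (hF : Fintype.card F = p ^ 3) (f : F → F)
    (hf : ∀ a : F, a ≠ 0 → Function.Bijective (fun x : F => f (x + a) - f x))
    {ι : Type*} [Fintype ι] (hι : Fintype.card ι < 3 * h) (b : ι → Bool) (t : ι → ℕ) :
    ∑ x, ∏ s, (if b s then x else f x) ^ p ^ t s = 0 := by
  classical
  have : Fact p.Prime := ⟨hp⟩
  have : CharP F p := by
    obtain ⟨c, hc⟩ := CharP.exists F
    obtain ⟨n, hc1, hc2⟩ := FiniteField.card F c
    rw [hF] at hc2
    have : c = p := by
      have h1 : c ∣ p ^ 3 := hc2 ▸ dvd_pow_self c n.ne_zero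
      exact (Nat.prime_dvd_prime_iff_eq hc1 hp).mp (hc1.dvd_of_dvd_pow h1)
    exact this ▸ hc
  let _ : Algebra (ZMod p) F := ZMod.algebra F p
  let B := Module.finBasis (ZMod p) F
  obtain ⟨c, hy⟩ : ∃ c : Fin (Module.finrank (ZMod p) F) → ℕ → F, ∀ (y : F) (n : ℕ), y ^ p ^ n
      = ∑ i, algebraMap (ZMod p) F (B.repr y i) * c i n := by
    refine ⟨fun i n => (B i) ^ p ^ n, fun y n => ?_⟩
    conv_lhs => rw [← B.sum_repr y]
    rw [sum_pow_char_pow]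
    refine Finset.sum_congr rfl fun i _ => ?_
    rw [Algebra.smul_def, mul_pow, ← map_pow, ZMod.pow_card_pow]
  simp_rw [hy, Finset.prod_univ_sum, Finset.prod_mul_distrib]
  rw [Finset.sum_comm]
  refine Finset.sum_eq_zero fun φ _ => ?_
  rw [← Finset.sum_mul]
  have h0 := pm_moment hp hph hF f hf hι
    (fun s => if b s then (B.coord (φ s)).toAddMonoidHom else 0)
    (fun s => if b s then 0 else (B.coord (φ s)).toAddMonoidHom)
  have h1 := congrArg (algebraMap (ZMod p) F) h0
  rw [map_sum, map_zero] at h1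
  simp only [map_prod] at h1
  convert zero_mul _
  rw [← h1]
  refine Finset.sum_congr rfl fun x _ => Finset.prod_congr rfl fun s _ => ?_
  by_cases hb : b s <;> simp [hb]

lemma pm_key {p h : ℕ} (hp : p.Prime) (hph : p = 2 * h + 1)
    {F : Type*} [Field F] [Fintype F]
    (hF : Fintype.card F = p ^ 3) (k : ℕ)
    (hf : ∀ a : F, a ≠ 0 → Function.Bijective (fun x : F => (x + a) ^ k - x ^ k))
    (r s : Fin 3 → ℕ) (hE : 0 < (∑ t, r t * p ^ (t : ℕ)) + k * ∑ t, s t * p ^ (t : ℕ))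
    (hdvd : p ^ 3 - 1 ∣ (∑ t, r t * p ^ (t : ℕ)) + k * ∑ t, s t * p ^ (t : ℕ)) :
    3 * h ≤ ∑ t, r t + ∑ t, s t := by
  classical
  by_contra hlt
  push Not at hlt
  let n : Bool × Fin 3 → ℕ := fun j => if j.1 then r j.2 else s j.2
  have hcard : Fintype.card (Σ j : Bool × Fin 3, Fin (n j)) < 3 * h := by
    rw [Fintype.card_sigma, Fintype.sum_prod_type]
    simpa [n] using hlt
  have h1 := pm_moment2 hp hph hF (fun x => x ^ k) hf hcard (fun j => j.1.1) (fun j => j.1.2)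
  have h2 : ∀ x : F, ∏ j : (Σ j : Bool × Fin 3, Fin (n j)),
      (if j.1.1 then x else x ^ k) ^ p ^ (j.1.2 : ℕ)
      = x ^ ((∑ t, r t * p ^ (t : ℕ)) + k * ∑ t, s t * p ^ (t : ℕ)) := by
    intro x
    rw [Fintype.prod_sigma, Fintype.prod_prod_type]
    simp only [Finset.prod_const, Finset.card_univ, Fintype.card_fin, Fintype.prod_bool, n,
      if_true, Bool.false_eq_true, if_false]
    simp only [← pow_mul, Finset.prod_pow_eq_pow_sum, ← pow_add]
    congr 1
    rw [Finset.mul_sum]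
    congr 1
    · exact Finset.sum_congr rfl fun _ _ => by ring
    · exact Finset.sum_congr rfl fun _ _ => by ring
  simp only [h2] at h1
  set E := (∑ t, r t * p ^ (t : ℕ)) + k * ∑ t, s t * p ^ (t : ℕ) with hEdef
  have h3 : ∀ x : F, x ^ E = 1 - if x = 0 then 1 else 0 := by
    intro x
    split_ifs with hx
    · rw [hx, zero_pow hE.ne', sub_self]
    · obtain ⟨c, hc⟩ := hdvd
      rw [hc, pow_mul, ← hF, FiniteField.pow_card_sub_one_eq_one x hx, one_pow, sub_zero]
  simp only [h3, Finset.sum_sub_distrib] at h1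
  have h4 : ((Fintype.card F : ℕ) : F) = 0 := by simp
  simp [h4] at h1

/-- The combinatorial consequence of planarity for an exponent with base `p = 2h+1` digits
`a, b, c` of sum `p + 1`. -/
def PMK (h a b c : ℕ) : Prop :=
  ∀ s0 s1 s2 e0 e1 e2 : ℕ,
    a * s0 + c * s1 + b * s2 + e2 ≤ (2 * h + 1) * e0 →
    b * s0 + a * s1 + c * s2 + e0 ≤ (2 * h + 1) * e1 →
    c * s0 + b * s1 + a * s2 + e1 ≤ (2 * h + 1) * e2 →
    e0 + e1 + e2 = s0 + s1 + s2 + 2 → s0 + s1 + s2 ≤ h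

lemma PMK.rot {h a b c : ℕ} (H : PMK h a b c) : PMK h b c a := by
  intro s0 s1 s2 e0 e1 e2 h0 h1 h2 h3
  exact H s0 s1 s2 e2 e0 e1 (by linarith) (by linarith) (by linarith) (by linarith)

lemma pm_even {h a b c : ℕ} (H : PMK h (2 * a) (2 * b) (2 * c)) (hs : a + b + c = h + 1)
    (ha : a + 1 ≤ h) (hb : b + 1 ≤ h) (hc : c + 1 ≤ h) : False := by
  have := H (h + 1) 0 1 (a + 1) (b + 1) (c + 1) (by nlinarith) (by nlinarith) (by nlinarith)
    (by omega)
  omega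

lemma pm_even' {h b c : ℕ} (hh : 2 ≤ h) (H : PMK h (2 * h) (2 * b) (2 * c)) (hs : b + c = 1) :
    False := by
  obtain ⟨rfl, rfl⟩ | ⟨rfl, rfl⟩ : (b = 1 ∧ c = 0) ∨ (b = 0 ∧ c = 1) := by omega
  · -- (p-1, 2, 0)
    by_cases h6 : 6 ≤ h
    · have := H h 0 2 h 2 2 (by nlinarith) (by nlinarith) (by nlinarith) (by omega)
      omega
    · interval_cases h
      · have := H 0 2 1 1 2 2; simp at this
      · have := H 0 2 2 1 2 3; simp at this
      · have := H 0 3 2 1 3 3; simp at this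
      · have := H 0 3 3 1 3 4; simp at this
  · -- (p-1, 0, 2)
    have H' := H.rot.rot
    by_cases h3 : 3 ≤ h
    · have := H' h 0 2 3 h 1 (by nlinarith) (by nlinarith) (by nlinarith) (by omega)
      omega
    · interval_cases h
      have := H' 0 1 2 2 1 2; simp at this

lemma pm_odd {h a b c : ℕ} (hh : 2 ≤ h) (H : PMK h (2 * a + 1) (2 * b + 1) (2 * c))
    (hs : a + b + c = h) (ha : 2 * a + 1 ≤ 2 * h) (hb : 2 * b + 1 ≤ 2 * h) :
    h = 2 ∧ a = 1 ∧ b = 0 ∧ c = 1 := by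
  by_cases hbc : 1 ≤ b ∧ 1 ≤ c
  · obtain ⟨hb1, hc1⟩ := hbc
    have := H (h + 1) 0 0 (a + 1) (b + 1) (c + 1) (by nlinarith) (by nlinarith) (by nlinarith)
      (by omega)
    omega
  rcases Nat.eq_zero_or_pos c with rfl | hc
  · exfalso
    have ha1 : 1 ≤ a := by omega
    by_cases hb2 : 2 ≤ b
    · have := H (h + 2) 0 1 (a + 2) (b + 2) 1 (by nlinarith) (by nlinarith) (by nlinarith)
        (by omega)
      omega
    · obtain rfl : b = 1 := by omega
      obtain rfl : h = a + 1 := by omega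
      have := H (a + 1) 0 1 (a + 1) 2 1 (by nlinarith) (by nlinarith) (by nlinarith) (by omega)
      omega
  · obtain rfl : b = 0 := by omega
    by_cases h1 : 1 ≤ a ∧ 3 ≤ c
    · obtain ⟨h1, h2⟩ := h1
      exfalso
      have := H (h + 1) 1 1 (a + 2) 2 (c + 1) (by nlinarith) (by nlinarith) (by nlinarith)
        (by omega)
      omega
    by_cases h2 : 4 * c + 1 ≤ 2 * h
    · exfalso
      have := H h 1 1 (a + 1) 2 (c + 1) (by nlinarith) (by nlinarith) (by nlinarith)
        (by omega)
      omega
    by_cases h3 : 2 * a + 4 ≤ c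
    · exfalso
      have := H h 1 1 (a + 2) 2 c (by nlinarith) (by nlinarith) (by nlinarith)
        (by omega)
      omega
    have h4 : h ≤ 4 := by omega
    have hc4 : c ≤ 4 := by omega
    interval_cases h
    · obtain ⟨rfl, rfl⟩ | ⟨rfl, rfl⟩ : (a = 1 ∧ c = 1) ∨ (a = 0 ∧ c = 2) := by omega
      · simp
      · have := H 0 2 1 2 2 1; simp at this
    · obtain ⟨rfl, rfl⟩ | ⟨rfl, rfl⟩ : (a = 1 ∧ c = 2) ∨ (a = 0 ∧ c = 3) := by omega
      · have := H 1 1 2 2 2 2; simp at this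
      · have := H 0 1 3 2 3 1; simp at this
    · obtain ⟨rfl, rfl⟩ : a = 2 ∧ c = 2 := by omega
      have := H 0 3 2 2 3 2; simp at this

/-- All exponents of digit sum `p + 1` are excluded, apart from a few for `p = 3, 5`. -/
lemma pm_comb {h a b c : ℕ} (hh : 2 ≤ h) (H : PMK h a b c) (hs : a + b + c = 2 * h + 2)
    (ha : a ≤ 2 * h) (hb : b ≤ 2 * h) (hc : c ≤ 2 * h) :
    h = 2 ∧ ((a = 3 ∧ b = 1 ∧ c = 2) ∨ (a = 1 ∧ b = 2 ∧ c = 3) ∨ (a = 2 ∧ b = 3 ∧ c = 1)) := by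
  obtain ⟨a', rfl | rfl⟩ := Nat.even_or_odd' a <;> obtain ⟨b', rfl | rfl⟩ := Nat.even_or_odd' b <;>
    obtain ⟨c', rfl | rfl⟩ := Nat.even_or_odd' c
  · exfalso
    by_cases h1 : a' = h
    · subst h1; exact pm_even' hh H (by omega)
    by_cases h2 : b' = h
    · subst h2; exact pm_even' hh H.rot (by omega)
    by_cases h3 : c' = h
    · subst h3; exact pm_even' hh H.rot.rot (by omega)
    exact pm_even H (by omega) (by omega) (by omega) (by omega)
  · omega
  · omega
  · have := pm_odd hh H.rot (by omega) (by omega) (by omega); omega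
  · omega
  · have := pm_odd hh H.rot.rot (by omega) (by omega) (by omega); omega
  · have := pm_odd hh H (by omega) (by omega) (by omega); omega
  · omega

/-- The conclusion of `pm_key` in explicit form. -/
def PMKey (h k : ℕ) : Prop :=
  ∀ r0 r1 r2 s0 s1 s2 : ℕ,
    0 < r0 + r1 * (2 * h + 1) + r2 * (2 * h + 1) ^ 2
      + k * (s0 + s1 * (2 * h + 1) + s2 * (2 * h + 1) ^ 2) →
    (2 * h + 1) ^ 3 - 1 ∣ r0 + r1 * (2 * h + 1) + r2 * (2 * h + 1) ^ 2
      + k * (s0 + s1 * (2 * h + 1) + s2 * (2 * h + 1) ^ 2) →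
    3 * h ≤ r0 + r1 + r2 + s0 + s1 + s2

lemma PMKey.congr {h k k' : ℕ} (H : PMKey h k) (hk : 0 < k) (hk' : 0 < k')
    (hkk : k ≡ k' [MOD (2 * h + 1) ^ 3 - 1]) : PMKey h k' := by
  intro r0 r1 r2 s0 s1 s2 h1 h2
  refine H r0 r1 r2 s0 s1 s2 ?_ ?_
  · by_contra h0
    have h3 : r0 + r1 * (2 * h + 1) + r2 * (2 * h + 1) ^ 2 = 0 ∧
      k * (s0 + s1 * (2 * h + 1) + s2 * (2 * h + 1) ^ 2) = 0 := by omega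
    have h4 := (Nat.mul_eq_zero.mp h3.2).resolve_left hk.ne'
    rw [h3.1, h4] at h1
    simp at h1
  · rw [← Nat.modEq_zero_iff_dvd] at h2 ⊢
    exact ((hkk.mul_right _).add_left _).trans h2

lemma PMKey.prime_field {h k : ℕ} (H : PMKey h k) (m j : ℕ) (h0 : 0 < m + k * j)
    (hd : 2 * h ∣ m + k * j) : h ≤ m + j := by
  have e : m + m * (2 * h + 1) + m * (2 * h + 1) ^ 2
      + k * (j + j * (2 * h + 1) + j * (2 * h + 1) ^ 2)
      = (m + k * j) * (1 + (2 * h + 1) + (2 * h + 1) ^ 2) := by ring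
  have := H m m m j j j (by rw [e]; positivity) (by
    rw [e]
    have : (2 * h + 1) ^ 3 - 1 = 2 * h * (1 + (2 * h + 1) + (2 * h + 1) ^ 2) := by
      rw [Nat.sub_eq_iff_eq_add (Nat.one_le_pow _ _ (by omega))]; ring
    rw [this]
    exact Nat.mul_dvd_mul_right hd _)
  omega

lemma PMKey.residue {h k : ℕ} (hh : 1 ≤ h) (hk : 0 < k) (hev : Even k) (H : PMKey h k) :
    k % (2 * h) = 2 % (2 * h) ∨ k % (2 * h) = h + 1 := by
  -- r in [1, 2h]
  obtain ⟨r, u, hr1, hr2, hku⟩ : ∃ r u, 1 ≤ r ∧ r ≤ 2 * h ∧ k = r + 2 * h * u := by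
    refine ⟨(k - 1) % (2 * h) + 1, (k - 1) / (2 * h), by omega, ?_, ?_⟩
    · have := Nat.mod_lt (k - 1) (show 0 < 2 * h by omega); omega
    · have := Nat.mod_add_div (k - 1) (2 * h); omega
  have hre : r % 2 = 0 := by
    have h1 := Nat.even_iff.mp hev
    have h2 : 2 * h * u = 2 * (h * u) := by ring
    omega
  have hmod : k % (2 * h) = r % (2 * h) := by rw [hku, Nat.add_mul_mod_self_left]
  have hle : r ≤ h + 1 := by
    have := H.prime_field (2 * h - r) 1 (by omega) ⟨u + 1, by
      have : 2 * h * (u + 1) = 2 * h * u + 2 * h := by ring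
      omega⟩
    omega
  by_cases h2 : r = 2
  · left; rw [hmod, h2]
  by_cases h3 : r = h + 1
  · right; rw [hmod, h3, Nat.mod_eq_of_lt (by omega)]
  exfalso
  have h4 : 4 ≤ r := by omega
  have hdm := Nat.mod_add_div (2 * h) r
  have hlt := Nat.mod_lt (2 * h) (show 0 < r by omega)
  set j := 2 * h / r with hj
  set m := 2 * h % r with hm
  have hj2 : 2 ≤ j := by
    rw [hj, Nat.le_div_iff_mul_le (by omega)]; omega
  have := H.prime_field m j (by positivity) ⟨1 + u * j, by
    rw [hku]
    linear_combination hdm⟩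
  nlinarith

lemma PMKey.toPMK {h a b c : ℕ} (h0 : 0 < a + b * (2 * h + 1) + c * (2 * h + 1) ^ 2)
    (H : PMKey h (a + b * (2 * h + 1) + c * (2 * h + 1) ^ 2))
    (hs : a + b + c = 2 * h + 2) : PMK h a b c := by
  intro s0 s1 s2 e0 e1 e2 i0 i1 i2 he
  obtain ⟨r0, hr0⟩ := Nat.exists_eq_add_of_le i0
  obtain ⟨r1, hr1⟩ := Nat.exists_eq_add_of_le i1
  obtain ⟨r2, hr2⟩ := Nat.exists_eq_add_of_le i2
  by_cases hs0 : s0 + s1 + s2 = 0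
  · omega
  have hS : 0 < s0 + s1 * (2 * h + 1) + s2 * (2 * h + 1) ^ 2 := by
    rcases Nat.eq_zero_or_pos s0 with h1 | h1
    · rcases Nat.eq_zero_or_pos s1 with h2 | h2
      · have : 0 < s2 := by omega
        positivity
      · positivity
    · positivity
  have key := H r0 r1 r2 s0 s1 s2 (by positivity) ⟨e2 + b * s2 + c * s1 + c * s2 * (2 * h + 1), by
    have hN : 1 ≤ (2 * h + 1) ^ 3 := Nat.one_le_pow _ _ (by omega)
    zify [hN] at *
    linear_combination -hr0 - (2 * h + 1) * hr1 - (2 * h + 1) ^ 2 * hr2⟩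
  have hsum : r0 + r1 + r2 + (2 * h + 2) * (s0 + s1 + s2) + (e0 + e1 + e2)
      = (2 * h + 1) * (e0 + e1 + e2) := by
    rw [← hs]
    linear_combination -hr0 - hr1 - hr2
  rw [he] at hsum
  nlinarith

lemma pm_digits {h k : ℕ} (hh : 1 ≤ h) (hk : 0 < k) (H : PMKey h k)
    (hmod : k % (2 * h) = 2 % (2 * h)) :
    ∃ a b c, a ≤ 2 * h ∧ b ≤ 2 * h ∧ c ≤ 2 * h ∧
      k ≡ a + b * (2 * h + 1) + c * (2 * h + 1) ^ 2 [MOD (2 * h + 1) ^ 3 - 1] ∧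
      (a + b + c = 2 ∨ (a + b + c = 2 * h + 2 ∧ PMK h a b c)) := by
  set p := 2 * h + 1 with hp
  have hN : (p ^ 3 - 1) + 1 = p ^ 3 := Nat.sub_add_cancel (Nat.one_le_pow _ _ (by omega))
  have hN1 : p ^ 3 - 1 = 2 * h * (1 + p + p ^ 2) := by
    have : p ^ 3 = 2 * h * (1 + p + p ^ 2) + 1 := by rw [hp]; ring
    omega
  have hNpos : 0 < p ^ 3 - 1 := by rw [hN1]; positivity
  set k' := (k - 1) % (p ^ 3 - 1) + 1 with hk'
  have hlt : k' < p ^ 3 := by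
    have := Nat.mod_lt (k - 1) hNpos; omega
  have hkk : k ≡ k' [MOD p ^ 3 - 1] := by
    have h1 : (k - 1) % (p ^ 3 - 1) ≡ k - 1 [MOD p ^ 3 - 1] := Nat.mod_modEq _ _
    have h2 := h1.add_right 1
    rw [Nat.sub_add_cancel hk] at h2
    exact h2.symm
  have H' := H.congr hk (by omega) hkk
  have hd : k' = k' % p + (k' / p % p) * p + (k' / p / p) * p ^ 2 := by
    have h1 := Nat.mod_add_div k' p
    have h2 := Nat.mod_add_div (k' / p) p
    calc k' = k' % p + p * (k' / p) := h1.symm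
      _ = k' % p + p * (k' / p % p + p * (k' / p / p)) := by rw [h2]
      _ = _ := by ring
  have hpp : 0 < p := by omega
  have ha : k' % p < p := Nat.mod_lt _ hpp
  have hb : k' / p % p < p := Nat.mod_lt _ hpp
  have hc : k' / p / p < p := by
    rw [Nat.div_div_eq_div_mul, Nat.div_lt_iff_lt_mul (by positivity)]
    calc k' < p ^ 3 := hlt
      _ = p * (p * p) := by ring
  have hk'pos : 0 < k' := by omega
  generalize k' % p = a at *
  generalize k' / p % p = b at *
  generalize k' / p / p = c at *
  have hsm : (a + b + c) % (2 * h) = 2 % (2 * h) := by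
    rw [← hmod]
    have h1 : k ≡ k' [MOD 2 * h] := hkk.of_dvd ⟨_, hN1⟩
    have h2 : k' = a + b + c + 2 * h * (b + c * (2 * h + 2)) := by
      rw [hd, hp]; ring
    have h3 : k' % (2 * h) = (a + b + c) % (2 * h) := by
      rw [h2, Nat.add_mul_mod_self_left]
    rw [← h3]; exact h1.symm
  have hpos : 0 < a + b + c := by
    by_contra h0
    have : a = 0 ∧ b = 0 ∧ c = 0 := by omega
    obtain ⟨rfl, rfl, rfl⟩ := this
    omega
  have hcases : a + b + c = 2 ∨ a + b + c = 2 * h + 2 ∨ a + b + c = 4 * h + 2 := by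
    have h1 : a + b + c ≡ 2 [MOD 2 * h] := hsm
    by_cases h5 : a + b + c < 2
    · have h6 := (Nat.modEq_iff_dvd' (by omega)).mp h1
      have h7 := Nat.le_of_dvd (by omega) h6
      omega
    · obtain ⟨t, ht⟩ := (Nat.modEq_iff_dvd' (by omega)).mp h1.symm
      have : t < 3 := by
        by_contra h3
        have : 2 * h * 3 ≤ 2 * h * t := Nat.mul_le_mul_left _ (by omega)
        omega
      interval_cases t <;> omega
  rw [hd] at hkk H' hk'pos
  refine ⟨a, b, c, by omega, by omega, by omega, hkk, ?_⟩
  rcases hcases with h1 | h1 | h1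
  · exact Or.inl h1
  · exact Or.inr ⟨h1, PMKey.toPMK hk'pos H' h1⟩
  · exfalso
    obtain ⟨a', ha'⟩ := Nat.exists_eq_add_of_le (show a ≤ 2 * h by omega)
    obtain ⟨b', hb'⟩ := Nat.exists_eq_add_of_le (show b ≤ 2 * h by omega)
    obtain ⟨c', hc'⟩ := Nat.exists_eq_add_of_le (show c ≤ 2 * h by omega)
    have := H' a' b' c' 1 0 0 (by simp only [one_mul, zero_mul, add_zero, mul_one]; omega) ⟨1, by
      rw [mul_one]
      have : p ^ 3 = 2 * h * (1 + p + p ^ 2) + 1 := by rw [hp]; ring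
      have h5 : 2 * h * (1 + p + p ^ 2) = 2 * h + 2 * h * p + 2 * h * p ^ 2 := by ring
      have h6 : 2 * h * p = b * p + b' * p := by rw [hb']; ring
      have h7 : 2 * h * p ^ 2 = c * p ^ 2 + c' * p ^ 2 := by rw [hc']; ring
      rw [← hp]
      simp only [one_mul, zero_mul, add_zero, mul_one]
      omega⟩
    omega

open Polynomial in
lemma pm_theta {p : ℕ} (hp : p.Prime) {F : Type*} [Field F] [Fintype F]
    (hF : Fintype.card F = p ^ 3) (c : ℕ) (hc : ∀ x : ZMod p, x ^ 3 ≠ x + c) :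
    ∃ θ : F, θ ^ 3 = θ + c := by
  have : Fact p.Prime := ⟨hp⟩
  let f : (ZMod p)[X] := X ^ 3 - X - C (c : ZMod p)
  have hd : f.natDegree = 3 := by
    simp only [f]; compute_degree!
  have hirr : Irreducible f := by
    apply irreducible_of_degree_le_three_of_not_isRoot
    · simp [hd]
    · intro x hx
      apply hc x
      simp only [f, IsRoot.def, eval_sub, eval_pow, eval_X, eval_C] at hx
      linear_combination hx
  have : Fact (Irreducible f) := ⟨hirr⟩
  have hmon : f.Monic := by
    simp only [f]; monicity!
  let pb := AdjoinRoot.powerBasis hirr.ne_zero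
  have : Module.Finite (ZMod p) (AdjoinRoot f) := pb.finite
  have : Finite (AdjoinRoot f) := Module.finite_of_finite (ZMod p)
  let : Fintype (AdjoinRoot f) := Fintype.ofFinite _
  have hcard : Fintype.card (AdjoinRoot f) = Fintype.card F := by
    rw [hF, Module.card_eq_pow_finrank (K := ZMod p) (V := AdjoinRoot f), pb.finrank,
      AdjoinRoot.powerBasis_dim, hd, ZMod.card]
  let e := FiniteField.ringEquivOfCardEq hcard
  refine ⟨e (AdjoinRoot.root f), ?_⟩
  have h1 : (AdjoinRoot.root f) ^ 3 = AdjoinRoot.root f + (c : AdjoinRoot f) := by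
    have := AdjoinRoot.eval₂_root f
    simp only [f, eval₂_sub, eval₂_pow, eval₂_X, eval₂_C] at this
    have h2 : (AdjoinRoot.of f) (c : ZMod p) = (c : AdjoinRoot f) := map_natCast _ _
    change AdjoinRoot.root f ^ 3 - AdjoinRoot.root f - (AdjoinRoot.of f) (c : ZMod p) = 0 at this
    rw [h2] at this
    linear_combination this
  rw [← map_pow, h1, map_add, map_natCast]

lemma pm_col8 {F : Type*} [Field F] (hp : (3 : F) = 0) (θ : F) (hθ : θ ^ 3 = θ + 1) :
    ∃ x y : F, x ≠ y ∧ (x + 1) ^ 8 - x ^ 8 = (y + 1) ^ 8 - y ^ 8 := by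
  refine ⟨θ, 1 + θ ^ 2, ?_, ?_⟩
  · intro h
    have ht : θ = -2 := by linear_combination (-θ - 1) * h - hθ
    rw [ht] at h
    exact one_ne_zero (α := F) (by linear_combination -h - 2 * hp)
  · linear_combination ((-5356) + (-5620) * θ ^ 1 + (-2062) * θ ^ 2 + (-3350) * θ ^ 3 + (-576) * θ ^ 4 + (-1542) * θ ^ 5 + (-100) * θ ^ 6 + (-484) * θ ^ 7 + (-8) * θ ^ 8 + (-92) * θ ^ 9 + (-8) * θ ^ 11) * hθ + ((-1870) + (-3656) * θ ^ 1 + (-2890) * θ ^ 2) * hp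

lemma pm_col14 {F : Type*} [Field F] (hp : (3 : F) = 0) (θ : F) (hθ : θ ^ 3 = θ + 1) :
    ∃ x y : F, x ≠ y ∧ (x + 1) ^ 14 - x ^ 14 = (y + 1) ^ 14 - y ^ 14 := by
  refine ⟨θ, 0, ?_, ?_⟩
  · intro h
    rw [h] at hθ
    exact one_ne_zero (α := F) (by linear_combination -hθ)
  · linear_combination ((23823) + (17971) * θ ^ 1 + (13498) * θ ^ 2 + (9961) * θ ^ 3 + (7009) * θ ^ 4 + (4487) * θ ^ 5 + (2471) * θ ^ 6 + (1106) * θ ^ 7 + (378) * θ ^ 8 + (91) * θ ^ 9 + (14) * θ ^ 10) * hθ + ((7941) + (13936) * θ ^ 1 + (10520) * θ ^ 2) * hp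

lemma pm_col58 {F : Type*} [Field F] (hp : (5 : F) = 0) (θ : F) (hθ : θ ^ 3 = θ + 2) :
    ∃ x y : F, x ≠ y ∧ (x + 1) ^ 58 - x ^ 58 = (y + 1) ^ 58 - y ^ 58 := by
  have A : ((1) * θ ^ 1 : F) ^ 58 = (2) + (3) * θ ^ 1 + (2) * θ ^ 2 := by
    have h5 : ((1) * θ ^ 1 : F) ^ 5 = (2) + (1) * θ ^ 1 + (2) * θ ^ 2 := by
      linear_combination ((1) + (1) * θ ^ 2) * hθ + (0) * hp
    have h25 : ((2) + (1) * θ ^ 1 + (2) * θ ^ 2 : F) ^ 5 = (3) + (3) * θ ^ 1 + (3) * θ ^ 2 := by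
      linear_combination ((3973) + (2580) * θ ^ 1 + (1609) * θ ^ 2 + (1002) * θ ^ 3 + (504) * θ ^ 4 + (272) * θ ^ 5 + (80) * θ ^ 6 + (32) * θ ^ 7) * hθ + ((1595) + (1842) * θ ^ 1 + (1207) * θ ^ 2) * hp
    calc ((1) * θ ^ 1 : F) ^ 58 = ((1) * θ ^ 1) ^ 3 * ((1) * θ ^ 1) ^ 5 * ((((1) * θ ^ 1) ^ 5) ^ 5) ^ 2 := by ring
      _ = ((1) * θ ^ 1) ^ 3 * ((2) + (1) * θ ^ 1 + (2) * θ ^ 2) * ((3) + (3) * θ ^ 1 + (3) * θ ^ 2) ^ 2 := by rw [h5, h25]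
      _ = (2) + (3) * θ ^ 1 + (2) * θ ^ 2 := by
        linear_combination ((666) + (441) * θ ^ 1 + (288) * θ ^ 2 + (180) * θ ^ 3 + (108) * θ ^ 4 + (45) * θ ^ 5 + (18) * θ ^ 6) * hθ + ((266) + (309) * θ ^ 1 + (203) * θ ^ 2) * hp
  have B : ((1) + (1) * θ ^ 1 : F) ^ 58 = (4) + (2) * θ ^ 1 + (2) * θ ^ 2 := by
    have h5 : ((1) + (1) * θ ^ 1 : F) ^ 5 = (3) + (1) * θ ^ 1 + (2) * θ ^ 2 := by
      linear_combination ((11) + (5) * θ ^ 1 + (1) * θ ^ 2) * hθ + ((4) + (5) * θ ^ 1 + (3) * θ ^ 2) * hp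
    have h25 : ((3) + (1) * θ ^ 1 + (2) * θ ^ 2 : F) ^ 5 = (4) + (3) * θ ^ 1 + (3) * θ ^ 2 := by
      linear_combination ((6943) + (4565) * θ ^ 1 + (2569) * θ ^ 2 + (1602) * θ ^ 3 + (664) * θ ^ 4 + (352) * θ ^ 5 + (80) * θ ^ 6 + (32) * θ ^ 7) * hθ + ((2825) + (3295) * θ ^ 1 + (2156) * θ ^ 2) * hp
    calc ((1) + (1) * θ ^ 1 : F) ^ 58 = ((1) + (1) * θ ^ 1) ^ 3 * ((1) + (1) * θ ^ 1) ^ 5 * ((((1) + (1) * θ ^ 1) ^ 5) ^ 5) ^ 2 := by ring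
      _ = ((1) + (1) * θ ^ 1) ^ 3 * ((3) + (1) * θ ^ 1 + (2) * θ ^ 2) * ((4) + (3) * θ ^ 1 + (3) * θ ^ 2) ^ 2 := by rw [h5, h25]
      _ = (4) + (2) * θ ^ 1 + (2) * θ ^ 2 := by
        linear_combination ((3878) + (2461) * θ ^ 1 + (1454) * θ ^ 2 + (756) * θ ^ 3 + (318) * θ ^ 4 + (99) * θ ^ 5 + (18) * θ ^ 6) * hθ + ((1560) + (1806) * θ ^ 1 + (1186) * θ ^ 2) * hp
  have C : ((3) * θ ^ 1 + (1) * θ ^ 2 : F) ^ 58 = (1) + (1) * θ ^ 1 + (3) * θ ^ 2 := by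
    have h5 : ((3) * θ ^ 1 + (1) * θ ^ 2 : F) ^ 5 = (3) + (4) * θ ^ 1 + (4) * θ ^ 2 := by
      linear_combination ((1764) + (1100) * θ ^ 1 + (712) * θ ^ 2 + (526) * θ ^ 3 + (287) * θ ^ 4 + (91) * θ ^ 5 + (15) * θ ^ 6 + (1) * θ ^ 7) * hθ + ((705) + (792) * θ ^ 1 + (504) * θ ^ 2) * hp
    have h25 : ((3) + (4) * θ ^ 1 + (4) * θ ^ 2 : F) ^ 5 = (4) + (3) * θ ^ 1 := by
      linear_combination ((229568) + (150240) * θ ^ 1 + (96640) * θ ^ 2 + (59264) * θ ^ 3 + (32768) * θ ^ 4 + (15104) * θ ^ 5 + (5120) * θ ^ 6 + (1024) * θ ^ 7) * hθ + ((91875) + (106333) * θ ^ 1 + (69892) * θ ^ 2) * hp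
    calc ((3) * θ ^ 1 + (1) * θ ^ 2 : F) ^ 58 = ((3) * θ ^ 1 + (1) * θ ^ 2) ^ 3 * ((3) * θ ^ 1 + (1) * θ ^ 2) ^ 5 * ((((3) * θ ^ 1 + (1) * θ ^ 2) ^ 5) ^ 5) ^ 2 := by ring
      _ = ((3) * θ ^ 1 + (1) * θ ^ 2) ^ 3 * ((3) + (4) * θ ^ 1 + (4) * θ ^ 2) * ((4) + (3) * θ ^ 1) ^ 2 := by rw [h5, h25]
      _ = (1) + (1) * θ ^ 1 + (3) * θ ^ 2 := by
        linear_combination ((48458) + (31914) * θ ^ 1 + (20802) * θ ^ 2 + (13180) * θ ^ 3 + (6883) * θ ^ 4 + (2383) * θ ^ 5 + (456) * θ ^ 6 + (36) * θ ^ 7) * hθ + ((19383) + (22457) * θ ^ 1 + (14703) * θ ^ 2) * hp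
  have D : ((1) + (3) * θ ^ 1 + (1) * θ ^ 2 : F) ^ 58 = (3) + (3) * θ ^ 2 := by
    have h5 : ((1) + (3) * θ ^ 1 + (1) * θ ^ 2 : F) ^ 5 = (4) + (4) * θ ^ 1 + (4) * θ ^ 2 := by
      linear_combination ((3364) + (2190) * θ ^ 1 + (1412) * θ ^ 2 + (811) * θ ^ 3 + (347) * θ ^ 4 + (96) * θ ^ 5 + (15) * θ ^ 6 + (1) * θ ^ 7) * hθ + ((1345) + (1551) * θ ^ 1 + (1021) * θ ^ 2) * hp
    have h25 : ((4) + (4) * θ ^ 1 + (4) * θ ^ 2 : F) ^ 5 = (3) * θ ^ 1 := by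
      linear_combination ((299008) + (194560) * θ ^ 1 + (122880) * θ ^ 2 + (72704) * θ ^ 3 + (37888) * θ ^ 4 + (16384) * θ ^ 5 + (5120) * θ ^ 6 + (1024) * θ ^ 7) * hθ + ((119808) + (138649) * θ ^ 1 + (91136) * θ ^ 2) * hp
    calc ((1) + (3) * θ ^ 1 + (1) * θ ^ 2 : F) ^ 58 = ((1) + (3) * θ ^ 1 + (1) * θ ^ 2) ^ 3 * ((1) + (3) * θ ^ 1 + (1) * θ ^ 2) ^ 5 * ((((1) + (3) * θ ^ 1 + (1) * θ ^ 2) ^ 5) ^ 5) ^ 2 := by ring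
      _ = ((1) + (3) * θ ^ 1 + (1) * θ ^ 2) ^ 3 * ((4) + (4) * θ ^ 1 + (4) * θ ^ 2) * ((3) * θ ^ 1) ^ 2 := by rw [h5, h25]
      _ = (3) + (3) * θ ^ 2 := by
        linear_combination ((21744) + (14328) * θ ^ 1 + (9432) * θ ^ 2 + (5976) * θ ^ 3 + (3456) * θ ^ 4 + (1476) * θ ^ 5 + (360) * θ ^ 6 + (36) * θ ^ 7) * hθ + ((8697) + (10080) * θ ^ 1 + (6645) * θ ^ 2) * hp
  refine ⟨θ, 3 * θ + θ ^ 2, ?_, ?_⟩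
  · intro h
    have h0 : θ * (θ + 2) = 0 := by linear_combination -h
    rcases mul_eq_zero.mp h0 with h1 | h1
    · rw [h1] at hθ
      exact one_ne_zero (α := F) (by linear_combination 2 * hθ + hp)
    · have h2 : θ = -2 := by linear_combination h1
      rw [h2] at hθ
      exact one_ne_zero (α := F) (by linear_combination -2 * hθ - 3 * hp)
  · have A' : θ ^ 58 = 2 + 3 * θ + 2 * θ ^ 2 := by simpa using A
    have B' : (θ + 1) ^ 58 = 4 + 2 * θ + 2 * θ ^ 2 := by rw [add_comm θ 1]; simpa using B
    have C' : (3 * θ + θ ^ 2) ^ 58 = 1 + θ + 3 * θ ^ 2 := by simpa using C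
    have D' : (3 * θ + θ ^ 2 + 1) ^ 58 = 3 + 3 * θ ^ 2 := by
      rw [show 3 * θ + θ ^ 2 + 1 = 1 + 3 * θ + θ ^ 2 by ring]; simpa using D
    rw [A', B', C', D']
    linear_combination 0 * hp

lemma pm_charP {p : ℕ} (hp : p.Prime) {F : Type*} [Field F] [Fintype F]
    (hF : Fintype.card F = p ^ 3) : CharP F p := by
  obtain ⟨c, hc⟩ := CharP.exists F
  obtain ⟨n, hc1, hc2⟩ := FiniteField.card F c
  rw [hF] at hc2
  have : c = p := by
    have h1 : c ∣ p ^ 3 := hc2 ▸ dvd_pow_self c n.ne_zero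
    exact (Nat.prime_dvd_prime_iff_eq hc1 hp).mp (hc1.dvd_of_dvd_pow h1)
  exact this ▸ hc

lemma pm_pow_congr {F : Type*} [Field F] [Fintype F] {k k' : ℕ} (hk : 0 < k) (hk' : 0 < k')
    (h : k ≡ k' [MOD Fintype.card F - 1]) (x : F) : x ^ k = x ^ k' := by
  by_cases hx : x = 0
  · rw [hx, zero_pow hk.ne', zero_pow hk'.ne']
  · have h1 : x ^ (Fintype.card F - 1) = 1 := FiniteField.pow_card_sub_one_eq_one x hx
    rw [← Nat.mod_add_div k (Fintype.card F - 1), ← Nat.mod_add_div k' (Fintype.card F - 1), h,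
      pow_add, pow_add, pow_mul, pow_mul, h1, one_pow, one_pow]

lemma pm_no_col {p : ℕ} (hp : p.Prime) {F : Type*} [Field F] [Fintype F]
    (hF : Fintype.card F = p ^ 3) {k : ℕ} (hk : 0 < k)
    (hf : ∀ a : F, a ≠ 0 → Function.Bijective (fun x : F => (x + a) ^ k - x ^ k))
    (k0 i : ℕ) (hk0 : 0 < k0) (h : k ≡ k0 * p ^ i [MOD p ^ 3 - 1])
    (hcol : ∃ x y : F, x ≠ y ∧ (x + 1) ^ k0 - x ^ k0 = (y + 1) ^ k0 - y ^ k0) : False := by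
  have := pm_charP hp hF
  have : Fact p.Prime := ⟨hp⟩
  obtain ⟨x, y, hxy, he⟩ := hcol
  have hc : ∀ z : F, z ^ k = (z ^ k0) ^ p ^ i := by
    intro z
    rw [← pow_mul]
    exact pm_pow_congr hk (Nat.mul_pos hk0 (pow_pos hp.pos _)) (by rwa [hF]) z
  apply hxy
  apply (hf 1 one_ne_zero).1
  simp only [hc]
  rw [← sub_pow_char_pow, ← sub_pow_char_pow, he]

lemma pm_back {p : ℕ} (hp : p.Prime) (hodd : Odd p) {F : Type*} [Field F] [Fintype F]
    (hF : Fintype.card F = p ^ 3) {k : ℕ} (hk : 0 < k) (i j : ℕ)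
    (h : k ≡ p ^ i + p ^ j [MOD p ^ 3 - 1]) (a : F) (ha : a ≠ 0) :
    Function.Bijective (fun x : F => (x + a) ^ k - x ^ k) := by
  have := pm_charP hp hF
  have : Fact p.Prime := ⟨hp⟩
  have h2 : (2 : F) ≠ 0 := by
    intro h0
    have : ((2 : ℕ) : F) = 0 := by exact_mod_cast h0
    rw [CharP.cast_eq_zero_iff F p] at this
    have := (Nat.prime_dvd_prime_iff_eq hp Nat.prime_two).mp this
    subst this
    exact absurd hodd (by decide)
  have hc : ∀ z : F, z ^ k = z ^ p ^ i * z ^ p ^ j := by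
    intro z
    rw [← pow_add]
    exact pm_pow_congr hk (by have := pow_pos hp.pos i; omega) (by rwa [hF]) z
  apply Finite.injective_iff_bijective.mp
  intro x y hxy
  simp only [hc, add_pow_char_pow] at hxy
  by_contra hne
  have hz : x - y ≠ 0 := sub_ne_zero.mpr hne
  have h3 : a ^ p ^ i * (x - y) ^ p ^ j = -(a ^ p ^ j * (x - y) ^ p ^ i) := by
    rw [sub_pow_char_pow, sub_pow_char_pow]
    linear_combination hxy
  have hN : ∀ (z : F) (t : ℕ), (z ^ p ^ t) ^ (1 + p + p ^ 2) = z ^ (1 + p + p ^ 2) := by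
    intro z t
    induction t with
    | zero => simp
    | succ t ih =>
      rw [pow_succ, pow_mul, ← pow_mul, ← ih]
      set w := z ^ p ^ t
      have hw : w ^ p ^ 3 = w := by rw [← hF]; exact FiniteField.pow_card w
      calc w ^ (p * (1 + p + p ^ 2)) = w ^ p * w ^ (p ^ 2) * w ^ p ^ 3 := by
            rw [← pow_add, ← pow_add]; congr 1; ring
        _ = w ^ (1 + p + p ^ 2) := by rw [hw, pow_add, pow_add]; ring
  have h4 := congrArg (fun z => z ^ (1 + p + p ^ 2)) h3
  have ho : Odd (1 + p + p ^ 2) := by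
    obtain ⟨m, rfl⟩ := hodd
    exact ⟨m + 1 + (2 * m ^ 2 + 2 * m), by ring⟩
  simp only [ho.neg_pow, mul_pow, hN] at h4
  have h5 : 2 * (a ^ (1 + p + p ^ 2) * (x - y) ^ (1 + p + p ^ 2)) = 0 := by linear_combination h4
  exact absurd h5 (mul_ne_zero h2 (mul_ne_zero (pow_ne_zero _ ha) (pow_ne_zero _ hz)))

lemma pm_cast_ne {p : ℕ} {F : Type*} [Field F] [CharP F p] {n : ℕ}
    (h : ¬ p ∣ n) : (n : F) ≠ 0 := fun h0 => h ((CharP.cast_eq_zero_iff F p n).mp h0)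

lemma pm_PMKey {p h : ℕ} (hp : p.Prime) (hph : p = 2 * h + 1) {F : Type*} [Field F] [Fintype F]
    (hF : Fintype.card F = p ^ 3) {k : ℕ}
    (hf : ∀ a : F, a ≠ 0 → Function.Bijective (fun x : F => (x + a) ^ k - x ^ k)) : PMKey h k := by
  intro r0 r1 r2 s0 s1 s2 h0 h1
  have := pm_key hp hph hF k hf ![r0, r1, r2] ![s0, s1, s2]
    (by simpa [Fin.sum_univ_three, hph] using h0)
    (by simpa [Fin.sum_univ_three, hph] using h1)
  simp [Fin.sum_univ_three] at this
  omega

lemma pm_k_even {F : Type*} [Field F]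
    {k : ℕ} (hk : 0 < k)
    (hf : ∀ a : F, a ≠ 0 → Function.Bijective (fun x : F => (x + a) ^ k - x ^ k)) : Even k := by
  by_contra hn
  rw [Nat.not_even_iff_odd] at hn
  have : (0 : F) = -1 := by
    apply (hf 1 one_ne_zero).1
    simp [hn.neg_pow, zero_pow hk.ne']
  exact one_ne_zero (α := F) (by linear_combination this)

lemma pm_half_case {p h : ℕ} (hp : p.Prime) (hph : p = 2 * h + 1) (hh : 2 ≤ h)
    {F : Type*} [Field F] [Fintype F]
    (hF : Fintype.card F = p ^ 3) {k : ℕ} (hk : 0 < k)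
    (hf : ∀ a : F, a ≠ 0 → Function.Bijective (fun x : F => (x + a) ^ k - x ^ k))
    (hmod : k % (2 * h) = h + 1) : False := by
  have := pm_charP hp hF
  have : Fact p.Prime := ⟨hp⟩
  have hnd : ∀ q : ℕ, 0 < q → q < 5 → (q : F) ≠ 0 := fun q h0 h5 =>
    pm_cast_ne (p := p) fun hd => by have := Nat.le_of_dvd h0 hd; omega
  have h3 : (3 : F) ≠ 0 := by exact_mod_cast hnd 3 (by norm_num) (by norm_num)
  have h4 : (4 : F) ≠ 0 := by exact_mod_cast hnd 4 (by norm_num) (by norm_num)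
  have hfix : ∀ n : ℕ, (n : F) ^ p = n := fun n => by
    rw [← frobenius_def, map_natCast]
  have hpw : ∀ s : F, s ^ p = s → (s ^ 2) ^ k = s ^ 2 := by
    intro s hs
    have h1 : ∀ m : ℕ, s ^ (2 * h * m + 2) = s ^ 2 := by
      intro m
      induction m with
      | zero => simp
      | succ m ih =>
        calc s ^ (2 * h * (m + 1) + 2) = s ^ (2 * h * m) * (s * s ^ p) := by
              rw [hph]; ring
          _ = s ^ (2 * h * m + 2) := by rw [hs]; ring
          _ = s ^ 2 := ih
    rw [← pow_mul]
    have h2 : 2 * k = 2 * h * (2 * (k / (2 * h)) + 1) + 2 := by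
      have := Nat.mod_add_div k (2 * h)
      rw [hmod] at this
      nth_rewrite 1 [← this]
      ring
    rw [h2, h1]
  have hs := hpw (5 / 4) (by
    rw [div_pow]; have a := hfix 5; have b := hfix 4; push_cast at a b; rw [a, b])
  have ht := hpw (3 / 4) (by
    rw [div_pow]; have a := hfix 3; have b := hfix 4; push_cast at a b; rw [a, b])
  have hs2 : ((3 / 4 : F)) ^ 2 + 1 = (5 / 4) ^ 2 := by field_simp; norm_num
  have : ((3 / 4 : F)) ^ 2 = 0 := by
    apply (hf 1 one_ne_zero).1
    simp only [zero_add, one_pow, zero_pow hk.ne', sub_zero]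
    rw [hs2, hs, ht, ← hs2]; ring
  exact pow_ne_zero 2 (div_ne_zero h3 h4) this

lemma pm_forward {p : ℕ} (hp : p.Prime) (hodd : Odd p) {F : Type*} [Field F] [Fintype F]
    (hF : Fintype.card F = p ^ 3) {k : ℕ} (hk : 0 < k)
    (hf : ∀ a : F, a ≠ 0 → Function.Bijective (fun x : F => (x + a) ^ k - x ^ k)) :
    ∃ i < 3, ∃ j < 3, k ≡ p ^ i + p ^ j [MOD p ^ 3 - 1] := by
  obtain ⟨h, hph⟩ := hodd
  have hh : 1 ≤ h := by have := hp.two_le; omega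
  have hev := pm_k_even hk hf
  have H := pm_PMKey hp hph hF hf
  have hcase : k % (2 * h) = 2 % (2 * h) := by
    rcases H.residue hh hk hev with h1 | h1
    · exact h1
    · by_cases h2 : 2 ≤ h
      · exact (pm_half_case hp hph h2 hF hk hf h1).elim
      · have : h = 1 := by omega
        subst this
        omega
  have := pm_charP hp hF
  obtain ⟨a, b, c, ha, hb, hc, hkk, hcs⟩ := pm_digits hh hk H hcase
  rw [← hph] at hkk
  rcases hcs with hs | ⟨hs, hK⟩
  · have fin : ∀ i < 3, ∀ j < 3, a + b * p + c * p ^ 2 = p ^ i + p ^ j →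
        ∃ i < 3, ∃ j < 3, k ≡ p ^ i + p ^ j [MOD p ^ 3 - 1] :=
      fun i hi j hj e => ⟨i, hi, j, hj, e ▸ hkk⟩
    have : (a = 2 ∧ b = 0 ∧ c = 0) ∨ (a = 0 ∧ b = 2 ∧ c = 0) ∨ (a = 0 ∧ b = 0 ∧ c = 2) ∨
        (a = 1 ∧ b = 1 ∧ c = 0) ∨ (a = 1 ∧ b = 0 ∧ c = 1) ∨ (a = 0 ∧ b = 1 ∧ c = 1) := by omega
    rcases this with ⟨rfl, rfl, rfl⟩ | ⟨rfl, rfl, rfl⟩ | ⟨rfl, rfl, rfl⟩ | ⟨rfl, rfl, rfl⟩ |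
      ⟨rfl, rfl, rfl⟩ | ⟨rfl, rfl, rfl⟩
    · exact fin 0 (by norm_num) 0 (by norm_num) (by ring)
    · exact fin 1 (by norm_num) 1 (by norm_num) (by ring)
    · exact fin 2 (by norm_num) 2 (by norm_num) (by ring)
    · exact fin 0 (by norm_num) 1 (by norm_num) (by ring)
    · exact fin 0 (by norm_num) 2 (by norm_num) (by ring)
    · exact fin 1 (by norm_num) 2 (by norm_num) (by ring)
  · exfalso
    by_cases h2 : 2 ≤ h
    · obtain ⟨rfl, hd⟩ := pm_comb h2 hK hs ha hb hc
      obtain rfl : p = 5 := hph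
      have h5 : (5 : F) = 0 := by exact_mod_cast CharP.cast_eq_zero F 5
      obtain ⟨θ, hθ⟩ := pm_theta hp hF 2 (by decide)
      have hcol := pm_col58 h5 θ (by exact_mod_cast hθ)
      rcases hd with ⟨rfl, rfl, rfl⟩ | ⟨rfl, rfl, rfl⟩ | ⟨rfl, rfl, rfl⟩
      · exact pm_no_col hp hF hk hf 58 0 (by norm_num) (hkk.trans (by decide)) hcol
      · exact pm_no_col hp hF hk hf 58 2 (by norm_num) (hkk.trans (by decide)) hcol
      · exact pm_no_col hp hF hk hf 58 1 (by norm_num) (hkk.trans (by decide)) hcol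
    · obtain rfl : h = 1 := by omega
      obtain rfl : p = 3 := hph
      have h3 : (3 : F) = 0 := by exact_mod_cast CharP.cast_eq_zero F 3
      obtain ⟨θ, hθ⟩ := pm_theta hp hF 1 (by decide)
      have hθ1 : θ ^ 3 = θ + 1 := by exact_mod_cast hθ
      have hcol := pm_col8 h3 θ hθ1
      have hcol2 := pm_col14 h3 θ hθ1
      have : (a = 2 ∧ b = 2 ∧ c = 0) ∨ (a = 0 ∧ b = 2 ∧ c = 2) ∨ (a = 2 ∧ b = 0 ∧ c = 2) ∨
          (a = 2 ∧ b = 1 ∧ c = 1) ∨ (a = 1 ∧ b = 2 ∧ c = 1) ∨ (a = 1 ∧ b = 1 ∧ c = 2) := by omega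
      rcases this with ⟨rfl, rfl, rfl⟩ | ⟨rfl, rfl, rfl⟩ | ⟨rfl, rfl, rfl⟩ | ⟨rfl, rfl, rfl⟩ |
        ⟨rfl, rfl, rfl⟩ | ⟨rfl, rfl, rfl⟩
      · exact pm_no_col hp hF hk hf 8 0 (by norm_num) (hkk.trans (by decide)) hcol
      · exact pm_no_col hp hF hk hf 8 1 (by norm_num) (hkk.trans (by decide)) hcol
      · exact pm_no_col hp hF hk hf 8 2 (by norm_num) (hkk.trans (by decide)) hcol
      · exact pm_no_col hp hF hk hf 14 0 (by norm_num) (hkk.trans (by decide)) hcol2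
      · exact pm_no_col hp hF hk hf 14 1 (by norm_num) (hkk.trans (by decide)) hcol2
      · exact pm_no_col hp hF hk hf 14 2 (by norm_num) (hkk.trans (by decide)) hcol2

theorem stmt_11 (p : ℕ) (hp : p.Prime) (hodd : Odd p) (k : ℕ) (hk : 0 < k)
    (F : Type*) [Field F] [Fintype F] (hF : Fintype.card F = p ^ 3) :
    (∀ a : F, a ≠ 0 → Function.Bijective (fun x : F => (x + a) ^ k - x ^ k)) ↔
      ∃ i < 3, ∃ j < 3, k ≡ p ^ i + p ^ j [MOD p ^ 3 - 1] := by
  constructor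
  · exact pm_forward hp hodd hF hk
  · rintro ⟨i, _, j, _, h⟩ a ha
    exact pm_back hp hodd hF hk i j h a ha
end
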